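/- arXiv:math/9801012 — 10 statements merged into one kernel-verified Lean document; each statement's English description precedes it below -/
import Mathlib

section
/- Let ε > 0, let c : [0,ε] → ℂ be continuous, and let y : [0,ε] → ℂ be twice continuously differentiable with y''(x) = c(x)·y(x) for all x ∈ [0,ε]. Let f, g : [0,ε] → ℂ be continuously differentiable with f(ε) = y(ε) and g(ε) = y'(ε). If b := ε·∫₀^ε |c(t)| dt < 1, then |y(0) − f(0)| ≤ (1/(1−b))·[ ∫₀^ε |f'(t) − g(t)| dt + ε·∫₀^ε |g'(t) − c(t)f(t)| dt ]. -/
/-- A function on `[a, b]` vanishing at `b` is bounded by the integral of any continuous majorant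
of its derivative. -/
theorem norm_le_integral_of_norm_deriv_le_of_eq_zero_right {E : Type*} [NormedAddCommGroup E]
    [NormedSpace ℝ E] [CompleteSpace E] {a b : ℝ} {w w' : ℝ → E} {h : ℝ → ℝ}
    (hw : ∀ x ∈ Set.Icc a b, HasDerivWithinAt w (w' x) (Set.Icc a b) x)
    (hw' : ContinuousOn w' (Set.Icc a b)) (hh : ContinuousOn h (Set.Icc a b))
    (hle : ∀ x ∈ Set.Icc a b, ‖w' x‖ ≤ h x) (hb : w b = 0) {x : ℝ} (hx : x ∈ Set.Icc a b) :
    ‖w x‖ ≤ ∫ t in a..b, h t := by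
  have hsub : Set.Icc x b ⊆ Set.Icc a b := Set.Icc_subset_Icc_left hx.1
  have hftc : ∫ t in x..b, w' t = w b - w x :=
    intervalIntegral.integral_eq_sub_of_hasDerivAt_of_le hx.2
      (fun t ht => ((hw t (hsub ht)).mono hsub).continuousWithinAt)
      (fun t ht => (hw t (hsub (Set.Ioo_subset_Icc_self ht))).hasDerivAt
        (Icc_mem_nhds (hx.1.trans_lt ht.1) ht.2))
      ((hw'.mono hsub).intervalIntegrable_of_Icc hx.2)
  have hint : IntervalIntegrable h MeasureTheory.volume a b :=
    hh.intervalIntegrable_of_Icc (hx.1.trans hx.2)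
  calc ‖w x‖ = ‖∫ t in x..b, w' t‖ := by rw [hftc, hb, zero_sub, norm_neg]
    _ ≤ ∫ t in x..b, ‖w' t‖ := intervalIntegral.norm_integral_le_integral_norm hx.2
    _ ≤ ∫ t in x..b, h t :=
        intervalIntegral.integral_mono_on hx.2
          ((hw'.mono hsub).norm.intervalIntegrable_of_Icc hx.2)
          ((hh.mono hsub).intervalIntegrable_of_Icc hx.2) (fun t ht => hle t (hsub ht))
    _ ≤ ∫ t in a..b, h t := by
        refine intervalIntegral.integral_mono_interval hx.1 hx.2 le_rfl ?_ hint
        filter_upwards [MeasureTheory.ae_restrict_mem measurableSet_Ioc] with t ht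
        exact (norm_nonneg _).trans (hle t (Set.Ioc_subset_Icc_self ht))

/-- **Theorem 5.1 (1)**: if `y'' = c·y` on `[0,ε]`, `f, g` are `C¹` with
`f(ε) = y(ε)`, `g(ε) = y'(ε)`, and `b = ε·∫₀^ε |c| < 1`, then
`|y(0) − f(0)| ≤ (1/(1−b))·[∫₀^ε |f' − g| + ε·∫₀^ε |g' − c·f|]`. -/
theorem abstract_endpoint_bound_first_component
    (ε : ℝ) (hε : 0 < ε)
    (c y y' y'' f f' g g' : ℝ → ℂ)
    (hc : ContinuousOn c (Set.Icc 0 ε))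
    (hy : ∀ x ∈ Set.Icc (0:ℝ) ε, HasDerivWithinAt y (y' x) (Set.Icc 0 ε) x)
    (hy' : ∀ x ∈ Set.Icc (0:ℝ) ε, HasDerivWithinAt y' (y'' x) (Set.Icc 0 ε) x)
    (hy'' : ContinuousOn y'' (Set.Icc 0 ε))
    (hode : ∀ x ∈ Set.Icc (0:ℝ) ε, y'' x = c x * y x)
    (hf : ∀ x ∈ Set.Icc (0:ℝ) ε, HasDerivWithinAt f (f' x) (Set.Icc 0 ε) x)
    (hf' : ContinuousOn f' (Set.Icc 0 ε))
    (hg : ∀ x ∈ Set.Icc (0:ℝ) ε, HasDerivWithinAt g (g' x) (Set.Icc 0 ε) x)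
    (hg' : ContinuousOn g' (Set.Icc 0 ε))
    (hfε : f ε = y ε) (hgε : g ε = y' ε)
    (hb : ε * ∫ t in (0:ℝ)..ε, ‖c t‖ < 1) :
    ‖y 0 - f 0‖ ≤ (1 / (1 - ε * ∫ t in (0:ℝ)..ε, ‖c t‖)) *
      ((∫ t in (0:ℝ)..ε, ‖f' t - g t‖) +
        ε * ∫ t in (0:ℝ)..ε, ‖g' t - c t * f t‖) := by
  have hcy : ContinuousOn y (Set.Icc 0 ε) := fun x hx => (hy x hx).continuousWithinAt
  have hcy' : ContinuousOn y' (Set.Icc 0 ε) := fun x hx => (hy' x hx).continuousWithinAt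
  have hcf : ContinuousOn f (Set.Icc 0 ε) := fun x hx => (hf x hx).continuousWithinAt
  have hcg : ContinuousOn g (Set.Icc 0 ε) := fun x hx => (hg x hx).continuousWithinAt
  obtain ⟨x₀, hx₀, hmax⟩ := isCompact_Icc.exists_isMaxOn
    (Set.nonempty_Icc.2 hε.le) (hcy.sub hcf).norm
  set M := ‖y x₀ - f x₀‖
  have hle : ∀ x ∈ Set.Icc 0 ε, ‖y x - f x‖ ≤ M := fun x hx => hmax hx
  set C := ∫ t in (0:ℝ)..ε, ‖c t‖
  set A := ∫ t in (0:ℝ)..ε, ‖f' t - g t‖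
  set B := ∫ t in (0:ℝ)..ε, ‖g' t - c t * f t‖
  have hres : ContinuousOn (fun t => ‖g' t - c t * f t‖) (Set.Icc 0 ε) :=
    (hg'.sub (hc.mul hcf)).norm
  have hdef : ContinuousOn (fun t => ‖f' t - g t‖) (Set.Icc 0 ε) := (hf'.sub hcg).norm
  have hv : ∀ x ∈ Set.Icc 0 ε, ‖y' x - g x‖ ≤ C * M + B := by
    intro x hx
    have key := norm_le_integral_of_norm_deriv_le_of_eq_zero_right
      (w := fun t => y' t - g t) (w' := fun t => y'' t - g' t)
      (h := fun t => ‖c t‖ * M + ‖g' t - c t * f t‖)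
      (fun t ht => (hy' t ht).sub (hg t ht)) (hy''.sub hg')
      ((hc.norm.mul continuousOn_const).add hres)
      (fun t ht => by
        have heq : y'' t - g' t = c t * (y t - f t) - (g' t - c t * f t) := by
          rw [hode t ht]; ring
        rw [heq]
        refine (norm_sub_le _ _).trans ?_
        rw [norm_mul]
        gcongr
        exact hle t ht)
      (sub_eq_zero.2 hgε.symm) hx
    rwa [intervalIntegral.integral_add
      ((hc.norm.intervalIntegrable_of_Icc hε.le).mul_const M)
      (hres.intervalIntegrable_of_Icc hε.le), intervalIntegral.integral_mul_const] at key
  have hu : M ≤ ε * (C * M + B) + A := by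
    have key := norm_le_integral_of_norm_deriv_le_of_eq_zero_right
      (w := fun t => y t - f t) (w' := fun t => y' t - f' t)
      (h := fun t => (C * M + B) + ‖f' t - g t‖)
      (fun t ht => (hy t ht).sub (hf t ht)) (hcy'.sub hf')
      (continuousOn_const.add hdef)
      (fun t ht => by
        have heq : y' t - f' t = (y' t - g t) - (f' t - g t) := by ring
        rw [heq]
        exact (norm_sub_le _ _).trans (by gcongr; exact hv t ht))
      (sub_eq_zero.2 hfε.symm) hx₀
    rwa [intervalIntegral.integral_add intervalIntegrable_const
      (hdef.intervalIntegrable_of_Icc hε.le), intervalIntegral.integral_const, sub_zero,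
      smul_eq_mul] at key
  refine (hle 0 (Set.left_mem_Icc.2 hε.le)).trans ?_
  rw [one_div, inv_mul_eq_div, le_div_iff₀ (sub_pos.2 hb)]
  linarith
end

section
/- Let ε > 0, let c : [0,ε] → ℂ be continuous, and let y : [0,ε] → ℂ be twice continuously differentiable with y''(x) = c(x)·y(x) for all x ∈ [0,ε]. Let f, g : [0,ε] → ℂ be continuously differentiable with f(ε) = y(ε) and g(ε) = y'(ε). If b := ε·∫₀^ε |c(t)| dt < 1, then |y'(0) − g(0)| ≤ (1/(1−b))·[ (∫₀^ε |c(t)| dt)·(∫₀^ε |f'(t) − g(t)| dt) + ∫₀^ε |g'(t) − c(t)f(t)| dt ]. -/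
open Set intervalIntegral in
/-- A `C¹` function vanishing at the right endpoint of an interval is bounded by the `L¹` norm of
its derivative. -/
theorem norm_le_integral_norm_deriv_of_right_eq_zero {E : Type*} [NormedAddCommGroup E]
    [NormedSpace ℝ E] [CompleteSpace E] {a b x : ℝ} {w w' : ℝ → E}
    (hw : ∀ t ∈ Icc a b, HasDerivWithinAt w (w' t) (Icc a b) t)
    (hw' : ContinuousOn w' (Icc a b)) (hb : w b = 0) (hx : x ∈ Icc a b) :
    ‖w x‖ ≤ ∫ t in a..b, ‖w' t‖ := by
  have hab : a ≤ b := hx.1.trans hx.2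
  have hsub : Icc x b ⊆ Icc a b := Icc_subset_Icc_left hx.1
  have ftc : ∫ t in x..b, w' t = w b - w x :=
    integral_eq_sub_of_hasDerivAt_of_le hx.2
      (fun t ht => ((hw t (hsub ht)).continuousWithinAt).mono hsub)
      (fun t ht => (hw t (hsub (Ioo_subset_Icc_self ht))).hasDerivAt
        (Icc_mem_nhds (hx.1.trans_lt ht.1) ht.2))
      ((hw'.mono hsub).intervalIntegrable_of_Icc hx.2)
  calc ‖w x‖ = ‖∫ t in x..b, w' t‖ := by rw [ftc, hb, zero_sub, norm_neg]
    _ ≤ ∫ t in x..b, ‖w' t‖ := norm_integral_le_integral_norm hx.2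
    _ ≤ ∫ t in a..b, ‖w' t‖ :=
      integral_mono_interval hx.1 hx.2 le_rfl (Filter.Eventually.of_forall fun _ => norm_nonneg _)
        (hw'.norm.intervalIntegrable_of_Icc hab)

/-- **Theorem 5.1 (1)**: if `y'' = c·y` on `[0,ε]`, `f, g` are `C¹` with
`f(ε) = y(ε)`, `g(ε) = y'(ε)`, and `b = ε·∫₀^ε |c| < 1`, then
`|y'(0) − g(0)| ≤ (1/(1−b))·[(∫₀^ε |c|)·∫₀^ε |f' − g| + ∫₀^ε |g' − c·f|]`. -/
theorem abstract_endpoint_bound_second_component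
    (ε : ℝ) (hε : 0 < ε)
    (c y y' y'' f f' g g' : ℝ → ℂ)
    (hc : ContinuousOn c (Set.Icc 0 ε))
    (hy : ∀ x ∈ Set.Icc (0:ℝ) ε, HasDerivWithinAt y (y' x) (Set.Icc 0 ε) x)
    (hy' : ∀ x ∈ Set.Icc (0:ℝ) ε, HasDerivWithinAt y' (y'' x) (Set.Icc 0 ε) x)
    (hy'' : ContinuousOn y'' (Set.Icc 0 ε))
    (hode : ∀ x ∈ Set.Icc (0:ℝ) ε, y'' x = c x * y x)
    (hf : ∀ x ∈ Set.Icc (0:ℝ) ε, HasDerivWithinAt f (f' x) (Set.Icc 0 ε) x)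
    (hf' : ContinuousOn f' (Set.Icc 0 ε))
    (hg : ∀ x ∈ Set.Icc (0:ℝ) ε, HasDerivWithinAt g (g' x) (Set.Icc 0 ε) x)
    (hg' : ContinuousOn g' (Set.Icc 0 ε))
    (hfε : f ε = y ε) (hgε : g ε = y' ε)
    (hb : ε * ∫ t in (0:ℝ)..ε, ‖c t‖ < 1) :
    ‖y' 0 - g 0‖ ≤ (1 / (1 - ε * ∫ t in (0:ℝ)..ε, ‖c t‖)) *
      ((∫ t in (0:ℝ)..ε, ‖c t‖) * (∫ t in (0:ℝ)..ε, ‖f' t - g t‖) +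
        ∫ t in (0:ℝ)..ε, ‖g' t - c t * f t‖) := by
  have hyc : ContinuousOn y (Set.Icc 0 ε) := fun t ht => (hy t ht).continuousWithinAt
  have hyc' : ContinuousOn y' (Set.Icc 0 ε) := fun t ht => (hy' t ht).continuousWithinAt
  have hfc : ContinuousOn f (Set.Icc 0 ε) := fun t ht => (hf t ht).continuousWithinAt
  have hgc : ContinuousOn g (Set.Icc 0 ε) := fun t ht => (hg t ht).continuousWithinAt
  have integrable {h : ℝ → ℝ} (hh : ContinuousOn h (Set.Icc 0 ε)) :
      IntervalIntegrable h MeasureTheory.volume 0 ε := hh.intervalIntegrable_of_Icc hε.le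
  have hzero : (0 : ℝ) ∈ Set.Icc 0 ε := ⟨le_rfl, hε.le⟩
  obtain ⟨m, hm, hmax⟩ := isCompact_Icc.exists_isMaxOn ⟨0, hzero⟩ (hyc'.sub hgc).norm
  set C := ∫ t in (0:ℝ)..ε, ‖c t‖
  set F := ∫ t in (0:ℝ)..ε, ‖f' t - g t‖
  set G := ∫ t in (0:ℝ)..ε, ‖g' t - c t * f t‖
  set V := ‖y' m - g m‖
  have first_component (x : ℝ) (hx : x ∈ Set.Icc 0 ε) : ‖y x - f x‖ ≤ ε * V + F := by
    calc ‖y x - f x‖ ≤ ∫ t in (0:ℝ)..ε, ‖y' t - f' t‖ :=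
          norm_le_integral_norm_deriv_of_right_eq_zero (w := fun t => y t - f t)
            (fun t ht => (hy t ht).sub (hf t ht)) (hyc'.sub hf') (by simp [hfε]) hx
      _ ≤ ∫ t in (0:ℝ)..ε, (V + ‖f' t - g t‖) := by
          refine intervalIntegral.integral_mono_on hε.le (integrable (hyc'.sub hf').norm)
            (integrable (continuousOn_const.add (hf'.sub hgc).norm)) fun t ht => ?_
          calc ‖y' t - f' t‖ = ‖(y' t - g t) - (f' t - g t)‖ := by congr 1; ring
            _ ≤ ‖y' t - g t‖ + ‖f' t - g t‖ := norm_sub_le _ _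
            _ ≤ V + ‖f' t - g t‖ := by gcongr; exact hmax ht
      _ = ε * V + F := by
          rw [intervalIntegral.integral_add (integrable continuousOn_const)
            (integrable (h := fun t => ‖f' t - g t‖) (hf'.sub hgc).norm)]
          simp [F]
  have second_component : V ≤ C * (ε * V + F) + G := by
    calc V ≤ ∫ t in (0:ℝ)..ε, ‖y'' t - g' t‖ :=
          norm_le_integral_norm_deriv_of_right_eq_zero (w := fun t => y' t - g t)
            (fun t ht => (hy' t ht).sub (hg t ht)) (hy''.sub hg') (by simp [hgε]) hm
      _ ≤ ∫ t in (0:ℝ)..ε, (‖c t‖ * (ε * V + F) + ‖g' t - c t * f t‖) := by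
          refine intervalIntegral.integral_mono_on hε.le (integrable (hy''.sub hg').norm)
            (integrable ((hc.norm.mul continuousOn_const).add (hg'.sub (hc.mul hfc)).norm))
            fun t ht => ?_
          calc ‖y'' t - g' t‖ = ‖c t * (y t - f t) - (g' t - c t * f t)‖ := by
                rw [hode t ht]; congr 1; ring
            _ ≤ ‖c t * (y t - f t)‖ + ‖g' t - c t * f t‖ := norm_sub_le _ _
            _ ≤ ‖c t‖ * (ε * V + F) + ‖g' t - c t * f t‖ := by
                rw [norm_mul]; gcongr; exact first_component t ht
      _ = C * (ε * V + F) + G := by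
          rw [intervalIntegral.integral_add
              (integrable (h := fun t => ‖c t‖ * (ε * V + F)) (hc.norm.mul continuousOn_const))
              (integrable (h := fun t => ‖g' t - c t * f t‖) (hg'.sub (hc.mul hfc)).norm),
            intervalIntegral.integral_mul_const]
  have hV0 : ‖y' 0 - g 0‖ ≤ V := hmax hzero
  rw [one_div_mul_eq_div, le_div_iff₀ (by linarith)]
  calc ‖y' 0 - g 0‖ * (1 - ε * C) ≤ V * (1 - ε * C) :=
        mul_le_mul_of_nonneg_right hV0 (by linarith)
    _ ≤ C * F + G := by linarith
end

section
/- Let ε > 0 and c : [0,ε] → ℂ continuous with ∫₀^ε |c(t)| dt > 0. For pairs v = (v₁, v₂) of continuous functions [0,ε] → ℂ let ‖v‖ := max over x ∈ [0,ε] of max{ |v₁(x)|/√ε , |v₂(x)|/√(∫₀^ε |c(t)| dt) }, and let T be the operator (Tv)(x) = ∫_ε^x M(t)·v(t) dt − ∫_ε^x τ(t) dt with M(t) = ((0,1),(c(t),0)) and τ a fixed pair of continuous functions. Then for all pairs v, ṽ of continuous functions, ‖Tv − Tṽ‖ ≤ √(ε·∫₀^ε |c(t)| dt)·‖v − ṽ‖;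 in particular, if ε·∫₀^ε |c(t)| dt < 1, then T is a contraction with respect to ‖·‖. -/
/-- First component of the integral operator
`(Tv)(x) = ∫_ε^x M(t)·v(t) dt − ∫_ε^x τ(t) dt` with `M(t) = ((0,1),(c(t),0))`. -/
noncomputable def Tcomp1 (ε : ℝ) (τ₁ v₂ : ℝ → ℂ) (x : ℝ) : ℂ :=
  (∫ t in ε..x, v₂ t) - ∫ t in ε..x, τ₁ t

/-- Second component of the integral operator
`(Tv)(x) = ∫_ε^x M(t)·v(t) dt − ∫_ε^x τ(t) dt` with `M(t) = ((0,1),(c(t),0))`. -/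
noncomputable def Tcomp2 (ε : ℝ) (c τ₂ v₁ : ℝ → ℂ) (x : ℝ) : ℂ :=
  (∫ t in ε..x, c t * v₁ t) - ∫ t in ε..x, τ₂ t

/-- The weighted supremum norm
`‖v‖ = max_{x∈[0,ε]} max{ |v₁(x)|/√ε , |v₂(x)|/√K }` (with `K = ∫₀^ε |c|`). -/
noncomputable def wnorm (ε K : ℝ) (v₁ v₂ : ℝ → ℂ) : ℝ :=
  ⨆ x : Set.Icc (0:ℝ) ε, max (‖v₁ (x : ℝ)‖ / Real.sqrt ε) (‖v₂ (x : ℝ)‖ / Real.sqrt K)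

open MeasureTheory in
/-- If `f` and `h` differ by at most `C` on `[0, ε]`, their integrals from `ε` to `x` against the
weight `g` differ by at most `C * ∫₀^ε ‖g‖`. -/
theorem norm_integral_mul_sub_le {ε C x : ℝ} {g f h : ℝ → ℂ}
    (hg : ContinuousOn g (Set.Icc 0 ε)) (hf : ContinuousOn f (Set.Icc 0 ε))
    (hh : ContinuousOn h (Set.Icc 0 ε)) (hx : x ∈ Set.Icc 0 ε)
    (hC : ∀ t ∈ Set.Icc 0 ε, ‖f t - h t‖ ≤ C) :
    ‖(∫ t in ε..x, g t * f t) - ∫ t in ε..x, g t * h t‖ ≤ C * ∫ t in (0:ℝ)..ε, ‖g t‖ := by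
  have hε : 0 ≤ ε := hx.1.trans hx.2
  have hsub : Set.uIcc ε x ⊆ Set.Icc 0 ε := by
    rw [Set.uIcc_of_ge hx.2]
    exact Set.Icc_subset_Icc_left hx.1
  have hC0 : 0 ≤ C := (norm_nonneg _).trans (hC x hx)
  have hgint : IntervalIntegrable (fun t => C * ‖g t‖) volume 0 ε :=
    (continuousOn_const.mul hg.norm).intervalIntegrable_of_Icc hε
  have hgint' : IntervalIntegrable (fun t => C * ‖g t‖) volume x ε :=
    ((continuousOn_const.mul hg.norm).mono
      (Set.Icc_subset_Icc_left hx.1)).intervalIntegrable_of_Icc hx.2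
  have hmul : ∀ {k : ℝ → ℂ}, ContinuousOn k (Set.Icc 0 ε) →
      IntervalIntegrable (fun t => g t * k t) volume ε x :=
    fun hk => ((hg.mul hk).mono hsub).intervalIntegrable
  rw [← intervalIntegral.integral_sub (hmul hf) (hmul hh), intervalIntegral.integral_symm, norm_neg,
    ← intervalIntegral.integral_const_mul]
  calc ‖∫ t in x..ε, g t * f t - g t * h t‖
      ≤ ∫ t in x..ε, C * ‖g t‖ := by
        refine intervalIntegral.norm_integral_le_of_norm_le hx.2
          (Filter.Eventually.of_forall fun t ht => ?_) hgint'
        rw [← mul_sub, norm_mul, mul_comm]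
        exact mul_le_mul_of_nonneg_right (hC t ⟨hx.1.trans ht.1.le, ht.2⟩) (norm_nonneg _)
    _ ≤ ∫ t in (0:ℝ)..ε, C * ‖g t‖ :=
        intervalIntegral.integral_mono_interval hx.1 hx.2 le_rfl
          (Filter.Eventually.of_forall fun t => mul_nonneg hC0 (norm_nonneg _)) hgint

/-- For continuous pairs, the weighted supremum norm bounds each weighted value. -/
theorem le_wnorm {ε K x : ℝ} {f g : ℝ → ℂ} (hf : ContinuousOn f (Set.Icc 0 ε))
    (hg : ContinuousOn g (Set.Icc 0 ε)) (hx : x ∈ Set.Icc 0 ε) :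
    max (‖f x‖ / Real.sqrt ε) (‖g x‖ / Real.sqrt K) ≤ wnorm ε K f g := by
  have hcont : ContinuousOn
      (fun x => max (‖f x‖ / Real.sqrt ε) (‖g x‖ / Real.sqrt K)) (Set.Icc 0 ε) :=
    (hf.norm.div_const _).sup (hg.norm.div_const _)
  have hbdd := isCompact_Icc.bddAbove_image hcont
  rw [Set.image_eq_range] at hbdd
  exact le_ciSup hbdd (⟨x, hx⟩ : Set.Icc (0:ℝ) ε)

/-- `‖Tv − Tṽ‖ ≤ √(ε·∫₀^ε |c|)·‖v − ṽ‖`; in particular, if `ε·∫₀^ε |c| < 1`,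
then `T` is a contraction with respect to `‖·‖`. -/
theorem operator_is_contraction
    (ε : ℝ) (hε : 0 < ε) (c τ₁ τ₂ : ℝ → ℂ)
    (hc : ContinuousOn c (Set.Icc 0 ε))
    (hcpos : 0 < ∫ t in (0:ℝ)..ε, ‖c t‖)
    (hτ₁ : ContinuousOn τ₁ (Set.Icc 0 ε)) (hτ₂ : ContinuousOn τ₂ (Set.Icc 0 ε))
    (v₁ v₂ w₁ w₂ : ℝ → ℂ)
    (hv₁ : ContinuousOn v₁ (Set.Icc 0 ε)) (hv₂ : ContinuousOn v₂ (Set.Icc 0 ε))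
    (hw₁ : ContinuousOn w₁ (Set.Icc 0 ε)) (hw₂ : ContinuousOn w₂ (Set.Icc 0 ε)) :
    wnorm ε (∫ t in (0:ℝ)..ε, ‖c t‖)
        (fun x => Tcomp1 ε τ₁ v₂ x - Tcomp1 ε τ₁ w₂ x)
        (fun x => Tcomp2 ε c τ₂ v₁ x - Tcomp2 ε c τ₂ w₁ x) ≤
      Real.sqrt (ε * ∫ t in (0:ℝ)..ε, ‖c t‖) *
        wnorm ε (∫ t in (0:ℝ)..ε, ‖c t‖)
          (fun t => v₁ t - w₁ t) (fun t => v₂ t - w₂ t) ∧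
    ((ε * ∫ t in (0:ℝ)..ε, ‖c t‖) < 1 →
      Real.sqrt (ε * ∫ t in (0:ℝ)..ε, ‖c t‖) < 1) := by
  refine ⟨?_, fun h => by rwa [Real.sqrt_lt' one_pos, one_pow]⟩
  set K := ∫ t in (0:ℝ)..ε, ‖c t‖ with hK
  set N := wnorm ε K (fun t => v₁ t - w₁ t) (fun t => v₂ t - w₂ t)
  have hsε := Real.sqrt_pos.2 hε
  have hsK := Real.sqrt_pos.2 hcpos
  have hN : ∀ t ∈ Set.Icc 0 ε,
      ‖v₁ t - w₁ t‖ / Real.sqrt ε ≤ N ∧ ‖v₂ t - w₂ t‖ / Real.sqrt K ≤ N :=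
    fun t ht => max_le_iff.1 (le_wnorm (hv₁.sub hw₁) (hv₂.sub hw₂) ht)
  have : Nonempty (Set.Icc (0:ℝ) ε) := ⟨⟨0, le_rfl, hε.le⟩⟩
  rw [wnorm, Real.sqrt_mul hε.le]
  refine ciSup_le fun x => max_le ?_ ?_
  · have h := norm_integral_mul_sub_le (g := fun _ => 1) continuousOn_const hv₂ hw₂ x.2
      fun t ht => (div_le_iff₀ hsK).1 (hN t ht).2
    simp only [one_mul, norm_one, intervalIntegral.integral_const, sub_zero, smul_eq_mul,
      mul_one] at h
    rw [div_le_iff₀ hsε, Tcomp1, Tcomp1, sub_sub_sub_cancel_right]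
    refine h.trans_eq ?_
    linear_combination -(N * Real.sqrt K) * Real.mul_self_sqrt hε.le
  · have h := norm_integral_mul_sub_le hc hv₁ hw₁ x.2
      fun t ht => (div_le_iff₀ hsε).1 (hN t ht).1
    rw [← hK] at h
    rw [div_le_iff₀ hsK, Tcomp2, Tcomp2, sub_sub_sub_cancel_right]
    refine h.trans_eq ?_
    linear_combination -(N * Real.sqrt ε) * Real.mul_self_sqrt hcpos.le
end

section
/- Let ε > 0, let c : [0,ε] → ℂ be continuous, let τ = (τ₁, τ₂) be a pair of continuous functions [0,ε] → ℂ, and assume b := ε·∫₀^ε |c(t)| dt < 1. Set α₁ := (1/(1−b))·[ ∫₀^ε |τ₁| dt + ε·∫₀^ε |τ₂| dt ] and α₂ := (1/(1−b))·[ (∫₀^ε |c| dt)·(∫₀^ε |τ₁| dt) + ∫₀^ε |τ₂| dt ]. Let T be the operator (Tv)(x) = ∫_ε^x M(t)·v(t) dt − ∫_ε^x τ(t) dt with M(t) = ((0,1),(c(t),0)). If v = (v₁, v₂) is a pair of continuous functions with |v₁(x)| ≤ α₁ and |v₂(x)| ≤ α₂ for all x ∈ [0,ε], then |(Tv)₁(x)|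 ≤ α₁ and |(Tv)₂(x)| ≤ α₂ for all x ∈ [0,ε]; that is, T maps the set U := { v : |v₁(x)| ≤ α₁, |v₂(x)| ≤ α₂ for all x ∈ [0,ε] } into itself. -/
/-- If `‖f‖ ≤ g` on `[a, b]`, the integral of `f` from `b` back to any point of `[a, b]` is bounded
by the integral of `g` over the whole interval. -/
theorem norm_integral_from_right_le {E : Type*} [NormedAddCommGroup E] [NormedSpace ℝ E]
    {a b x : ℝ} {f : ℝ → E} {g : ℝ → ℝ} (hg : ContinuousOn g (Set.Icc a b))
    (hfg : ∀ t ∈ Set.Icc a b, ‖f t‖ ≤ g t) (hx : x ∈ Set.Icc a b) :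
    ‖∫ t in b..x, f t‖ ≤ ∫ t in a..b, g t := by
  have hab : a ≤ b := hx.1.trans hx.2
  have hgi : IntervalIntegrable g MeasureTheory.volume a b :=
    hg.intervalIntegrable_of_Icc hab
  have hgx : IntervalIntegrable g MeasureTheory.volume x b :=
    (hg.mono (Set.Icc_subset_Icc_left hx.1)).intervalIntegrable_of_Icc hx.2
  rw [intervalIntegral.integral_symm, norm_neg]
  calc ‖∫ t in x..b, f t‖ ≤ ∫ t in x..b, g t :=
        intervalIntegral.norm_integral_le_of_norm_le hx.2
          (Filter.Eventually.of_forall fun t ht => hfg t ⟨hx.1.trans ht.1.le, ht.2⟩) hgx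
    _ ≤ ∫ t in a..b, g t := by
        refine intervalIntegral.integral_mono_interval hx.1 hx.2 le_rfl ?_ hgi
        refine (MeasureTheory.ae_restrict_iff' measurableSet_Ioc).2
          (Filter.Eventually.of_forall fun t ht => ?_)
        exact (norm_nonneg _).trans (hfg t ⟨ht.1.le, ht.2⟩)

/-- With `b = ε·∫₀^ε |c| < 1`,
`α₁ = (1/(1−b))·[∫₀^ε |τ₁| + ε·∫₀^ε |τ₂|]`,
`α₂ = (1/(1−b))·[(∫₀^ε |c|)·∫₀^ε |τ₁| + ∫₀^ε |τ₂|]`,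
the operator `T` maps the set
`U = { v : |v₁(x)| ≤ α₁, |v₂(x)| ≤ α₂ on [0,ε] }` into itself. -/
theorem operator_maps_U_into_itself
    (ε : ℝ) (hε : 0 < ε) (c τ₁ τ₂ : ℝ → ℂ)
    (hc : ContinuousOn c (Set.Icc 0 ε))
    (hτ₁ : ContinuousOn τ₁ (Set.Icc 0 ε)) (hτ₂ : ContinuousOn τ₂ (Set.Icc 0 ε))
    (hb : ε * ∫ t in (0:ℝ)..ε, ‖c t‖ < 1)
    (α₁ α₂ : ℝ)
    (hα₁ : α₁ = (1 / (1 - ε * ∫ t in (0:ℝ)..ε, ‖c t‖)) *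
      ((∫ t in (0:ℝ)..ε, ‖τ₁ t‖) + ε * ∫ t in (0:ℝ)..ε, ‖τ₂ t‖))
    (hα₂ : α₂ = (1 / (1 - ε * ∫ t in (0:ℝ)..ε, ‖c t‖)) *
      ((∫ t in (0:ℝ)..ε, ‖c t‖) * (∫ t in (0:ℝ)..ε, ‖τ₁ t‖) +
        ∫ t in (0:ℝ)..ε, ‖τ₂ t‖))
    (v₁ v₂ : ℝ → ℂ)
    (hv₁ : ContinuousOn v₁ (Set.Icc 0 ε)) (hv₂ : ContinuousOn v₂ (Set.Icc 0 ε))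
    (hv₁bd : ∀ x ∈ Set.Icc (0:ℝ) ε, ‖v₁ x‖ ≤ α₁)
    (hv₂bd : ∀ x ∈ Set.Icc (0:ℝ) ε, ‖v₂ x‖ ≤ α₂) :
    ∀ x ∈ Set.Icc (0:ℝ) ε,
      ‖Tcomp1 ε τ₁ v₂ x‖ ≤ α₁ ∧ ‖Tcomp2 ε c τ₂ v₁ x‖ ≤ α₂ := by
  intro x hx
  have hτ₁x := norm_integral_from_right_le hτ₁.norm (fun t _ => le_rfl) hx
  have hτ₂x := norm_integral_from_right_le hτ₂.norm (fun t _ => le_rfl) hx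
  have hv₂x := norm_integral_from_right_le continuousOn_const hv₂bd hx
  have hcv₁x : ‖∫ t in ε..x, c t * v₁ t‖ ≤ ∫ t in (0:ℝ)..ε, ‖c t‖ * α₁ := by
    refine norm_integral_from_right_le (hc.norm.mul continuousOn_const) (fun t ht => ?_) hx
    rw [norm_mul]
    exact mul_le_mul_of_nonneg_left (hv₁bd t ht) (norm_nonneg _)
  rw [intervalIntegral.integral_const, smul_eq_mul, sub_zero] at hv₂x
  rw [intervalIntegral.integral_mul_const] at hcv₁x
  have hb' : 1 - ε * ∫ t in (0:ℝ)..ε, ‖c t‖ ≠ 0 := by linarith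
  have hα₁_eq : α₁ = ε * α₂ + ∫ t in (0:ℝ)..ε, ‖τ₁ t‖ := by
    rw [hα₁, hα₂]
    field_simp
    ring
  have hα₂_eq : α₂ = (∫ t in (0:ℝ)..ε, ‖c t‖) * α₁ + ∫ t in (0:ℝ)..ε, ‖τ₂ t‖ := by
    rw [hα₁, hα₂]
    field_simp
    ring
  constructor
  · rw [hα₁_eq]
    exact (norm_sub_le _ _).trans (add_le_add hv₂x hτ₁x)
  · rw [hα₂_eq]
    exact (norm_sub_le _ _).trans (add_le_add hcv₁x hτ₂x)
end

section
/- Let ε > 0, let c : [0,ε] → ℂ be continuous with 0 < ∫₀^ε |c(t)| dt and b := ε·∫₀^ε |c(t)| dt < 1, and let τ = (τ₁, τ₂) be a pair of continuous functions [0,ε] → ℂ. Set α₁ := (1/(1−b))·[ ∫₀^ε |τ₁| dt + ε·∫₀^ε |τ₂| dt ] and α₂ := (1/(1−b))·[ (∫₀^ε |c| dt)·(∫₀^ε |τ₁| dt) + ∫₀^ε |τ₂| dt ]. Then the operator T defined on pairs of continuous functions [0,ε] → ℂ by (Tv)(x) = ∫_ε^x M(t)·v(t) dt − ∫_ε^x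 τ(t) dt, with M(t) = ((0,1),(c(t),0)), has exactly one fixed point u, and this fixed point satisfies |u₁(x)| ≤ α₁ and |u₂(x)| ≤ α₂ for all x ∈ [0,ε]. -/
open Set intervalIntegral MeasureTheory

lemma norm_integral_mul_le_of_norm_le {ε A : ℝ} (hε : 0 ≤ ε) {g v : ℝ → ℂ}
    (hg : ContinuousOn g (Icc 0 ε)) (hv : ∀ t ∈ Icc 0 ε, ‖v t‖ ≤ A)
    {x : ℝ} (hx : x ∈ Icc 0 ε) :
    ‖∫ t in ε..x, g t * v t‖ ≤ (∫ t in (0:ℝ)..ε, ‖g t‖) * A := by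
  have hA : 0 ≤ A := (norm_nonneg _).trans (hv x hx)
  have hint : IntervalIntegrable (fun t => ‖g t‖ * A) volume 0 ε :=
    ContinuousOn.intervalIntegrable_of_Icc hε (hg.norm.mul continuousOn_const)
  calc ‖∫ t in ε..x, g t * v t‖ = ‖∫ t in x..ε, g t * v t‖ := by
        rw [integral_symm, norm_neg]
    _ ≤ ∫ t in x..ε, ‖g t‖ * A := by
        refine norm_integral_le_of_norm_le hx.2 (ae_of_all _ fun t ht => ?_)
          (hint.mono_set ?_)
        · rw [norm_mul]
          exact mul_le_mul_of_nonneg_left (hv t ⟨hx.1.trans ht.1.le, ht.2⟩) (norm_nonneg _)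
        · rw [uIcc_of_le hx.2, uIcc_of_le hε]
          exact Icc_subset_Icc_left hx.1
    _ ≤ ∫ t in (0:ℝ)..ε, ‖g t‖ * A :=
        integral_mono_interval hx.1 hx.2 le_rfl
          (ae_of_all _ fun t => mul_nonneg (norm_nonneg _) hA) hint
    _ = (∫ t in (0:ℝ)..ε, ‖g t‖) * A := integral_mul_const _ _

lemma norm_integral_le_integral_norm_Icc {ε : ℝ} (hε : 0 ≤ ε) {τ : ℝ → ℂ}
    (hτ : ContinuousOn τ (Icc 0 ε)) {x : ℝ} (hx : x ∈ Icc 0 ε) :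
    ‖∫ t in ε..x, τ t‖ ≤ ∫ t in (0:ℝ)..ε, ‖τ t‖ := by
  simpa using norm_integral_mul_le_of_norm_le (v := fun _ => 1) (A := 1) hε hτ (by simp) hx

lemma Tcomp1_eq_Tcomp2 (ε : ℝ) (τ v : ℝ → ℂ) (x : ℝ) :
    Tcomp1 ε τ v x = Tcomp2 ε 1 τ v x := by
  simp [Tcomp1, Tcomp2]

lemma norm_Tcomp2_le {ε A : ℝ} (hε : 0 ≤ ε) {g τ v : ℝ → ℂ}
    (hg : ContinuousOn g (Icc 0 ε)) (hτ : ContinuousOn τ (Icc 0 ε))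
    (hv : ∀ t ∈ Icc 0 ε, ‖v t‖ ≤ A) {x : ℝ} (hx : x ∈ Icc 0 ε) :
    ‖Tcomp2 ε g τ v x‖ ≤ (∫ t in (0:ℝ)..ε, ‖g t‖) * A + ∫ t in (0:ℝ)..ε, ‖τ t‖ :=
  (norm_sub_le _ _).trans (add_le_add (norm_integral_mul_le_of_norm_le hε hg hv hx)
    (norm_integral_le_integral_norm_Icc hε hτ hx))

lemma Tcomp2_sub {ε : ℝ} {g τ v w : ℝ → ℂ}
    (hg : ContinuousOn g (Icc 0 ε)) (hv : ContinuousOn v (Icc 0 ε))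
    (hw : ContinuousOn w (Icc 0 ε)) {x : ℝ} (hx : x ∈ Icc 0 ε) :
    Tcomp2 ε g τ v x - Tcomp2 ε g τ w x = Tcomp2 ε g 0 (v - w) x := by
  have hsub : uIcc ε x ⊆ Icc 0 ε := by
    rw [uIcc_of_ge hx.2]
    exact Icc_subset_Icc_left hx.1
  simp only [Tcomp2, Pi.sub_apply, Pi.zero_apply, mul_sub, intervalIntegral.integral_zero, sub_zero]
  have hgv : IntervalIntegrable (fun t => g t * v t) volume ε x :=
    ((hg.mul hv).mono hsub).intervalIntegrable
  have hgw : IntervalIntegrable (fun t => g t * w t) volume ε x :=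
    ((hg.mul hw).mono hsub).intervalIntegrable
  rw [integral_sub hgv hgw]
  ring

lemma continuousOn_Tcomp2 {ε : ℝ} (hε : 0 ≤ ε) {g τ v : ℝ → ℂ}
    (hg : ContinuousOn g (Icc 0 ε)) (hτ : ContinuousOn τ (Icc 0 ε))
    (hv : ContinuousOn v (Icc 0 ε)) : ContinuousOn (Tcomp2 ε g τ v) (Icc 0 ε) := by
  have primitive {f : ℝ → ℂ} (hf : ContinuousOn f (Icc 0 ε)) :
      ContinuousOn (fun x => ∫ t in ε..x, f t) (Icc 0 ε) := by
    have h := continuousOn_primitive_interval' (a := ε)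
      (hf.intervalIntegrable_of_Icc (μ := volume) hε) right_mem_uIcc
    rwa [uIcc_of_le hε] at h
  exact (primitive (hg.mul hv)).sub (primitive hτ)

lemma integral_norm_one (ε : ℝ) : ∫ t in (0:ℝ)..ε, ‖(1 : ℝ → ℂ) t‖ = ε := by
  simp

/-- The a priori bounds satisfied by every continuous fixed point. -/
lemma norm_fixedPoint_le {ε : ℝ} (hε : 0 ≤ ε) {c τ₁ τ₂ w₁ w₂ : ℝ → ℂ}
    (hc : ContinuousOn c (Icc 0 ε)) (hb : ε * ∫ t in (0:ℝ)..ε, ‖c t‖ < 1)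
    (hτ₁ : ContinuousOn τ₁ (Icc 0 ε)) (hτ₂ : ContinuousOn τ₂ (Icc 0 ε))
    (hw₁ : ContinuousOn w₁ (Icc 0 ε)) (hw₂ : ContinuousOn w₂ (Icc 0 ε))
    (hw : ∀ x ∈ Icc (0:ℝ) ε, w₁ x = Tcomp1 ε τ₁ w₂ x ∧ w₂ x = Tcomp2 ε c τ₂ w₁ x)
    {x : ℝ} (hx : x ∈ Icc 0 ε) :
    ‖w₁ x‖ ≤ (1 / (1 - ε * ∫ t in (0:ℝ)..ε, ‖c t‖)) *
      ((∫ t in (0:ℝ)..ε, ‖τ₁ t‖) + ε * ∫ t in (0:ℝ)..ε, ‖τ₂ t‖) ∧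
    ‖w₂ x‖ ≤ (1 / (1 - ε * ∫ t in (0:ℝ)..ε, ‖c t‖)) *
      ((∫ t in (0:ℝ)..ε, ‖c t‖) * (∫ t in (0:ℝ)..ε, ‖τ₁ t‖) +
        ∫ t in (0:ℝ)..ε, ‖τ₂ t‖) := by
  obtain ⟨x₁, hx₁, hmax₁⟩ := isCompact_Icc.exists_isMaxOn ⟨x, hx⟩ hw₁.norm
  obtain ⟨x₂, hx₂, hmax₂⟩ := isCompact_Icc.exists_isMaxOn ⟨x, hx⟩ hw₂.norm
  have h₁ := norm_Tcomp2_le hε (g := 1) continuousOn_const hτ₁ hmax₂ hx₁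
  have h₂ := norm_Tcomp2_le hε hc hτ₂ hmax₁ hx₂
  rw [← Tcomp1_eq_Tcomp2, ← (hw x₁ hx₁).1, integral_norm_one] at h₁
  rw [← (hw x₂ hx₂).2] at h₂
  have hC : 0 ≤ ∫ t in (0:ℝ)..ε, ‖c t‖ := integral_nonneg hε fun _ _ => norm_nonneg _
  have hpos := sub_pos.mpr hb
  simp only [one_div_mul_eq_div]
  refine ⟨(hmax₁ hx).trans ?_, (hmax₂ hx).trans ?_⟩
  · rw [le_div_iff₀ hpos]
    nlinarith [mul_le_mul_of_nonneg_left h₂ hε]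
  · rw [le_div_iff₀ hpos]
    nlinarith [mul_le_mul_of_nonneg_left h₁ hC]

/-- The operator `Tcomp2` acting on continuous functions on `[0, ε]`. -/
noncomputable def volterraMap {ε : ℝ} (hε : 0 ≤ ε) {g τ : ℝ → ℂ}
    (hg : ContinuousOn g (Icc 0 ε)) (hτ : ContinuousOn τ (Icc 0 ε))
    (v : C(Icc 0 ε, ℂ)) : C(Icc 0 ε, ℂ) where
  toFun := (Icc 0 ε).domRestrict (Tcomp2 ε g τ (IccExtend hε v))
  continuous_toFun :=
    (continuousOn_Tcomp2 hε hg hτ v.continuous.Icc_extend'.continuousOn).domRestrict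

lemma dist_volterraMap_le {ε : ℝ} (hε : 0 ≤ ε) {g τ : ℝ → ℂ}
    (hg : ContinuousOn g (Icc 0 ε)) (hτ : ContinuousOn τ (Icc 0 ε))
    (v w : C(Icc 0 ε, ℂ)) :
    dist (volterraMap hε hg hτ v) (volterraMap hε hg hτ w) ≤
      (∫ t in (0:ℝ)..ε, ‖g t‖) * dist v w := by
  have hG : 0 ≤ ∫ t in (0:ℝ)..ε, ‖g t‖ := integral_nonneg hε fun _ _ => norm_nonneg _
  rw [ContinuousMap.dist_le (mul_nonneg hG dist_nonneg)]
  intro x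
  change dist (Tcomp2 ε g τ (IccExtend hε v) x) (Tcomp2 ε g τ (IccExtend hε w) x) ≤ _
  rw [dist_eq_norm, Tcomp2_sub hg v.continuous.Icc_extend'.continuousOn
    w.continuous.Icc_extend'.continuousOn x.2]
  have h := norm_Tcomp2_le hε hg (τ := 0) continuousOn_const (A := dist v w)
    (v := IccExtend hε v - IccExtend hε w) (fun t _ => ?_) x.2
  · simpa using h
  · rw [Pi.sub_apply, ← dist_eq_norm]
    exact ContinuousMap.dist_apply_le_dist _

lemma exists_fixedPoint {ε : ℝ} (hε : 0 ≤ ε) {c τ₁ τ₂ : ℝ → ℂ}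
    (hc : ContinuousOn c (Icc 0 ε)) (hb : ε * ∫ t in (0:ℝ)..ε, ‖c t‖ < 1)
    (hτ₁ : ContinuousOn τ₁ (Icc 0 ε)) (hτ₂ : ContinuousOn τ₂ (Icc 0 ε)) :
    ∃ u₁ u₂ : ℝ → ℂ, ContinuousOn u₁ (Icc 0 ε) ∧ ContinuousOn u₂ (Icc 0 ε) ∧
      ∀ x ∈ Icc (0:ℝ) ε, u₁ x = Tcomp1 ε τ₁ u₂ x ∧ u₂ x = Tcomp2 ε c τ₂ u₁ x := by
  have hC : 0 ≤ ∫ t in (0:ℝ)..ε, ‖c t‖ := integral_nonneg hε fun _ _ => norm_nonneg _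
  let S₁ := volterraMap hε (g := 1) continuousOn_const hτ₁
  let S₂ := volterraMap hε hc hτ₂
  have hS : ContractingWith (ε * ∫ t in (0:ℝ)..ε, ‖c t‖).toNNReal (S₂ ∘ S₁) := by
    refine ⟨by simpa using hb, LipschitzWith.of_dist_le_mul fun v w => ?_⟩
    rw [Real.coe_toNNReal _ (mul_nonneg hε hC)]
    have h₁ := dist_volterraMap_le hε (g := 1) continuousOn_const hτ₁ v w
    rw [integral_norm_one] at h₁
    calc dist (S₂ (S₁ v)) (S₂ (S₁ w))
        ≤ (∫ t in (0:ℝ)..ε, ‖c t‖) * dist (S₁ v) (S₁ w) := dist_volterraMap_le hε hc hτ₂ _ _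
      _ ≤ (∫ t in (0:ℝ)..ε, ‖c t‖) * (ε * dist v w) := mul_le_mul_of_nonneg_left h₁ hC
      _ = _ := by ring
  obtain ⟨u, hu⟩ : ∃ u, S₂ (S₁ u) = u := ⟨_, hS.fixedPoint_isFixedPt⟩
  refine ⟨IccExtend hε (S₁ u), IccExtend hε u, (S₁ u).continuous.Icc_extend'.continuousOn,
    u.continuous.Icc_extend'.continuousOn, fun x hx => ⟨?_, ?_⟩⟩
  · rw [IccExtend_of_mem hε _ hx, Tcomp1_eq_Tcomp2]
    rfl
  · rw [IccExtend_of_mem hε _ hx]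
    exact (DFunLike.congr_fun hu ⟨x, hx⟩).symm

/-- If `0 < ∫₀^ε |c|` and `b = ε·∫₀^ε |c| < 1`, then the operator `T`, acting
on pairs of continuous functions on `[0,ε]`, has exactly one fixed point
`u = (u₁, u₂)` (uniqueness meaning: any continuous fixed point agrees with it
on `[0,ε]`), and this fixed point satisfies `|u₁(x)| ≤ α₁`, `|u₂(x)| ≤ α₂`
on `[0,ε]`, where `α₁ = (1/(1−b))·[∫₀^ε |τ₁| + ε·∫₀^ε |τ₂|]` and
`α₂ = (1/(1−b))·[(∫₀^ε |c|)·∫₀^ε |τ₁| + ∫₀^ε |τ₂|]`. -/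
theorem operator_has_unique_fixed_point_with_bounds
    (ε : ℝ) (hε : 0 < ε) (c τ₁ τ₂ : ℝ → ℂ)
    (hc : ContinuousOn c (Set.Icc 0 ε))
    (hcpos : 0 < ∫ t in (0:ℝ)..ε, ‖c t‖)
    (hb : ε * ∫ t in (0:ℝ)..ε, ‖c t‖ < 1)
    (hτ₁ : ContinuousOn τ₁ (Set.Icc 0 ε)) (hτ₂ : ContinuousOn τ₂ (Set.Icc 0 ε))
    (α₁ α₂ : ℝ)
    (hα₁ : α₁ = (1 / (1 - ε * ∫ t in (0:ℝ)..ε, ‖c t‖)) *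
      ((∫ t in (0:ℝ)..ε, ‖τ₁ t‖) + ε * ∫ t in (0:ℝ)..ε, ‖τ₂ t‖))
    (hα₂ : α₂ = (1 / (1 - ε * ∫ t in (0:ℝ)..ε, ‖c t‖)) *
      ((∫ t in (0:ℝ)..ε, ‖c t‖) * (∫ t in (0:ℝ)..ε, ‖τ₁ t‖) +
        ∫ t in (0:ℝ)..ε, ‖τ₂ t‖)) :
    ∃ u₁ u₂ : ℝ → ℂ,
      ContinuousOn u₁ (Set.Icc 0 ε) ∧ ContinuousOn u₂ (Set.Icc 0 ε) ∧
      (∀ x ∈ Set.Icc (0:ℝ) ε,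
        u₁ x = Tcomp1 ε τ₁ u₂ x ∧ u₂ x = Tcomp2 ε c τ₂ u₁ x) ∧
      (∀ x ∈ Set.Icc (0:ℝ) ε, ‖u₁ x‖ ≤ α₁ ∧ ‖u₂ x‖ ≤ α₂) ∧
      (∀ w₁ w₂ : ℝ → ℂ,
        ContinuousOn w₁ (Set.Icc 0 ε) → ContinuousOn w₂ (Set.Icc 0 ε) →
        (∀ x ∈ Set.Icc (0:ℝ) ε,
          w₁ x = Tcomp1 ε τ₁ w₂ x ∧ w₂ x = Tcomp2 ε c τ₂ w₁ x) →
        ∀ x ∈ Set.Icc (0:ℝ) ε, w₁ x = u₁ x ∧ w₂ x = u₂ x) := by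
  obtain ⟨u₁, u₂, hu₁, hu₂, hu⟩ := exists_fixedPoint hε.le hc hb hτ₁ hτ₂
  refine ⟨u₁, u₂, hu₁, hu₂, hu, fun x hx => ?_, fun w₁ w₂ hw₁ hw₂ hw x hx => ?_⟩
  · rw [hα₁, hα₂]
    exact norm_fixedPoint_le hε.le hc hb hτ₁ hτ₂ hu₁ hu₂ hu hx
  · have h := norm_fixedPoint_le hε.le hc hb (τ₁ := 0) (τ₂ := 0) continuousOn_const
      continuousOn_const (hw₁.sub hu₁) (hw₂.sub hu₂) (fun y hy => ⟨?_, ?_⟩) hx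
    · simpa [sub_eq_zero] using h
    · rw [Pi.sub_apply, (hw y hy).1, (hu y hy).1]
      simp only [Tcomp1_eq_Tcomp2]
      exact Tcomp2_sub continuousOn_const hw₂ hu₂ hy
    · rw [Pi.sub_apply, (hw y hy).2, (hu y hy).2]
      exact Tcomp2_sub hc hw₁ hu₁ hy
end

section
/- Let n ≥ 1, let I ⊆ ℝ be an open interval, let D be a constant n×n complex diagonal matrix, let ρ : I → ℂ be continuous, and let R, P : I → Matrix n n ℂ with P differentiable, such that for every x ∈ I: P(x)·D − D·P(x) = R(x) − dg R(x) (where dg R(x) denotes the diagonal matrix with the same diagonal entries as R(x)), I + P(x) is invertible, and ρ(x) ≠ 0. If Z : I → ℂⁿ is differentiable with Z'(x) = ρ(x)·(D + R(x))·Z(x) on I, then W(x) := (I + P(x))⁻¹·Z(x) is differentiable and satisfies W'(x) = ρ(x)·( D̃(x) + S(x) )·W(x), where D̃(x) = D + dg R(x) and S(x) = (I + P(x))⁻¹·( R(x)·P(x) − P(x)·dg R(x) − ρ(x)⁻¹·P'(x) ). -/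
open Matrix

section MatrixDerivative

variable {m : Type*} [Fintype m] [DecidableEq m]

attribute [local instance] Matrix.linftyOpNormedRing Matrix.linftyOpNormedAlgebra

/-- The entrywise derivative of `A⁻¹` is `-(A⁻¹ * A' * A⁻¹)`. -/
theorem Matrix.hasDerivAt_inv_apply {A : ℝ → Matrix m m ℂ} {A' : Matrix m m ℂ} {x : ℝ}
    (hA : ∀ i j, HasDerivAt (fun t => A t i j) (A' i j) x) (hx : IsUnit (A x)) (i j : m) :
    HasDerivAt (fun t => (A t)⁻¹ i j) ((-((A x)⁻¹ * A' * (A x)⁻¹)) i j) x := by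
  have hA_matrix : HasDerivAt A A' x :=
    hasDerivAt_pi.2 fun i => hasDerivAt_pi.2 fun j => hA i j
  obtain ⟨u, hu⟩ := hx
  have hinv := hasFDerivAt_ringInverse (𝕜 := ℝ) u
  rw [hu] at hinv
  have h := hinv.comp_hasDerivAt x hA_matrix
  have h' := hasDerivAt_pi.1 (hasDerivAt_pi.1 h i) j
  simpa [Function.comp_def, ← Matrix.nonsing_inv_eq_ringInverse, ← hu,
    Matrix.coe_units_inv] using h'

end MatrixDerivative

/-- The product rule for a matrix-vector product, with the matrix differentiated entrywise. -/
theorem Matrix.hasDerivAt_mulVec {m k : Type*} [Fintype m] [Fintype k]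
    {A : ℝ → Matrix m k ℂ} {A' : Matrix m k ℂ} {v : ℝ → k → ℂ} {v' : k → ℂ} {x : ℝ}
    (hA : ∀ i j, HasDerivAt (fun t => A t i j) (A' i j) x) (hv : HasDerivAt v v' x) :
    HasDerivAt (fun t => A t *ᵥ v t) (A' *ᵥ v x + A x *ᵥ v') x := by
  refine hasDerivAt_pi.2 fun i => ?_
  simp only [Matrix.mulVec, dotProduct, Pi.add_apply, ← Finset.sum_add_distrib]
  exact HasDerivAt.fun_sum fun j _ => (hA i j).mul (hasDerivAt_pi.1 hv j)

/-- The coefficient matrices before and after the substitution `Z = (1 + P) W`. -/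
theorem Matrix.add_mul_one_add_eq_of_commutator {m α : Type*} [Fintype m] [DecidableEq m] [Ring α]
    {D R P G : Matrix m m α} (h : P * D - D * P = R - G) :
    (D + R) * (1 + P) = (1 + P) * (D + G) + (R * P - P * G) := by
  rw [sub_eq_iff_eq_add] at h
  simp only [add_mul, mul_add, one_mul, mul_one, h]
  abel

/-- One step of Eastham's approximate diagonalization for `Z' = ρ(D + R)Z`:
if `P·D − D·P = R − dg R`, `I + P` is invertible and `ρ ≠ 0` on the open
interval `I`, then `W = (I + P)⁻¹·Z` satisfies `W' = ρ·(D̃ + S)·W`, where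
`D̃ = D + dg R` and `S = (I + P)⁻¹·(R·P − P·dg R − ρ⁻¹·P')`.
Here `dg R(x)` denotes the diagonal matrix with the diagonal entries of
`R(x)`, and differentiability of the matrix `P` is expressed entrywise. -/
theorem approximate_diagonalization_step
    (n : ℕ) (hn : 1 ≤ n)
    (I : Set ℝ) (hIopen : IsOpen I) (hIinterval : I.OrdConnected)
    (D : Matrix (Fin n) (Fin n) ℂ) (hD : D.IsDiag)
    (ρ : ℝ → ℂ) (hρcont : ContinuousOn ρ I) (hρ : ∀ x ∈ I, ρ x ≠ 0)
    (R P P' : ℝ → Matrix (Fin n) (Fin n) ℂ)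
    (hP : ∀ x ∈ I, ∀ i j, HasDerivAt (fun t => P t i j) (P' x i j) x)
    (hPD : ∀ x ∈ I, P x * D - D * P x = R x - Matrix.diagonal (fun i => R x i i))
    (hinv : ∀ x ∈ I, IsUnit (1 + P x))
    (Z : ℝ → Fin n → ℂ)
    (hZ : ∀ x ∈ I, HasDerivAt Z (ρ x • ((D + R x).mulVec (Z x))) x) :
    ∀ x ∈ I,
      HasDerivAt (fun t => ((1 + P t)⁻¹).mulVec (Z t))
        (ρ x • (((D + Matrix.diagonal (fun i => R x i i) +
            (1 + P x)⁻¹ * (R x * P x - P x * Matrix.diagonal (fun i => R x i i) -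
              (ρ x)⁻¹ • P' x))).mulVec
          (((1 + P x)⁻¹).mulVec (Z x)))) x := by
  intro x hx
  have hA : ∀ i j, HasDerivAt (fun t => (1 + P t) i j) (P' x i j) x := fun i j => by
    simpa only [Matrix.add_apply] using (hP x hx i j).const_add _
  have hdet : IsUnit (1 + P x).det := (Matrix.isUnit_iff_isUnit_det _).1 (hinv x hx)
  convert Matrix.hasDerivAt_mulVec (Matrix.hasDerivAt_inv_apply hA (hinv x hx)) (hZ x hx) using 1
  have hcoeff := Matrix.add_mul_one_add_eq_of_commutator (hPD x hx)
  set G := Matrix.diagonal (fun i => R x i i)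
  have hZW : Z x = (1 + P x) *ᵥ ((1 + P x)⁻¹ *ᵥ Z x) := by
    rw [Matrix.mulVec_mulVec, Matrix.mul_nonsing_inv _ hdet, Matrix.one_mulVec]
  have hconj : (1 + P x)⁻¹ * ((D + R x) * (1 + P x)) =
      D + G + (1 + P x)⁻¹ * (R x * P x - P x * G) := by
    rw [hcoeff, mul_add, Matrix.nonsing_inv_mul_cancel_left _ _ hdet]
  have hsecond : (1 + P x)⁻¹ *ᵥ (ρ x • (D + R x) *ᵥ Z x) =
      (ρ x • (D + G + (1 + P x)⁻¹ * (R x * P x - P x * G))) *ᵥ ((1 + P x)⁻¹ *ᵥ Z x) := by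
    rw [← hconj]
    conv_lhs => rw [hZW]
    simp only [Matrix.mulVec_smul, Matrix.mulVec_mulVec, Matrix.smul_mul, Matrix.smul_mulVec,
      Matrix.mul_assoc]
  rw [hsecond, ← neg_mul, ← Matrix.mulVec_mulVec, ← Matrix.add_mulVec, ← Matrix.smul_mulVec]
  congr 1
  simp only [mul_sub _ _ ((ρ x)⁻¹ • P' x), Matrix.mul_smul, smul_add, smul_sub,
    smul_inv_smul₀ (hρ x hx)]
  abel
end

section
/- Let λ ∈ ℂ and ε > 0 with ε²·(|λ| + (2/3)·√ε) < 1. Let y : [0,ε] → ℂ be twice continuously differentiable with y''(x) = (−√x − λ)·y(x) for all x ∈ [0,ε], and set A₀ = y(ε), A₁ = y'(ε). Then |y(0) − (A₀ − ε·A₁)| ≤ [ ε² / (1 − ε²·(|λ| + (2/3)·√ε)) ] · { ((1/2)·|λ| + (5/6)·√ε)·|A₀| + ε·((1/2)·|λ| + (4/15)·√ε)·|A₁| }. -/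
/-- If `f'` is bounded by the derivative of `B` in terms of the distance to the right endpoint,
and `f` vanishes there, then `f` is bounded by `B` of that distance. -/
theorem norm_le_of_norm_deriv_le_of_right_eq_zero {f f' : ℝ → ℂ} {B B' : ℝ → ℝ} {ε : ℝ}
    (hf : ∀ x ∈ Set.Icc (0 : ℝ) ε, HasDerivWithinAt f (f' x) (Set.Icc 0 ε) x)
    (hfε : f ε = 0) (hB : ∀ u, HasDerivAt B (B' u) u) (hB0 : B 0 = 0)
    (hbound : ∀ x ∈ Set.Icc (0 : ℝ) ε, ‖f' x‖ ≤ B' (ε - x)) :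
    ∀ x ∈ Set.Icc (0 : ℝ) ε, ‖f x‖ ≤ B (ε - x) := by
  have hmaps : Set.MapsTo (fun u : ℝ => ε - u) (Set.Icc 0 ε) (Set.Icc 0 ε) := fun u hu =>
    ⟨by linarith [hu.2], by linarith [hu.1]⟩
  have hderiv : ∀ u ∈ Set.Icc (0 : ℝ) ε,
      HasDerivWithinAt (fun u => f (ε - u)) (-f' (ε - u)) (Set.Icc 0 ε) u := by
    intro u hu
    have hsub : HasDerivWithinAt (fun u : ℝ => ε - u) (-1) (Set.Icc 0 ε) u :=
      (hasDerivWithinAt_id u _).const_sub ε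
    simpa [Function.comp_def] using (hf (ε - u) (hmaps hu)).scomp u hsub hmaps
  have key := image_norm_le_of_norm_deriv_right_le_deriv_boundary
    (f := fun u => f (ε - u)) (f' := fun u => -f' (ε - u)) (a := 0) (b := ε)
    (fun u hu => (hderiv u hu).continuousWithinAt)
    (fun u hu => (hderiv u (Set.Ico_subset_Icc_self hu)).mono_of_mem_nhdsWithin
      (Icc_mem_nhdsGE_of_mem hu))
    (B := B) (B' := B') (by simp [hfε, hB0]) hB
    (fun u hu => by
      simpa using hbound (ε - u) (hmaps (Set.Ico_subset_Icc_self hu)))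
  intro x hx
  simpa using key (hmaps hx)

/-- Enclosure for `y(0)` for the equation `y'' = (−√x − λ)·y` on `[0,ε]`
in terms of `A₀ = y(ε)`, `A₁ = y'(ε)`, provided `ε²(|λ| + (2/3)√ε) < 1`. -/
theorem sqrt_potential_endpoint_bound_y
    (lam : ℂ) (ε : ℝ) (hε : 0 < ε)
    (hb : ε ^ 2 * (‖lam‖ + (2 / 3) * Real.sqrt ε) < 1)
    (y y' y'' : ℝ → ℂ)
    (hy : ∀ x ∈ Set.Icc (0:ℝ) ε, HasDerivWithinAt y (y' x) (Set.Icc 0 ε) x)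
    (hy' : ∀ x ∈ Set.Icc (0:ℝ) ε, HasDerivWithinAt y' (y'' x) (Set.Icc 0 ε) x)
    (hy'' : ContinuousOn y'' (Set.Icc 0 ε))
    (hode : ∀ x ∈ Set.Icc (0:ℝ) ε,
      y'' x = (-(Real.sqrt x : ℂ) - lam) * y x)
    (A₀ A₁ : ℂ) (hA₀ : A₀ = y ε) (hA₁ : A₁ = y' ε) :
    ‖y 0 - (A₀ - (ε : ℂ) * A₁)‖ ≤
      (ε ^ 2 / (1 - ε ^ 2 * (‖lam‖ + (2 / 3) * Real.sqrt ε))) *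
        (((1 / 2) * ‖lam‖ + (5 / 6) * Real.sqrt ε) * ‖A₀‖ +
          ε * ((1 / 2) * ‖lam‖ + (4 / 15) * Real.sqrt ε) * ‖A₁‖) := by
  set r : ℝ → ℂ := fun x => y x - (A₀ + ((x - ε : ℝ) : ℂ) * A₁) with hr_def
  have hr : ∀ x ∈ Set.Icc (0 : ℝ) ε, HasDerivWithinAt r (y' x - A₁) (Set.Icc 0 ε) x := by
    intro x hx
    have hlin : HasDerivWithinAt (fun x : ℝ => ((x - ε : ℝ) : ℂ)) 1 (Set.Icc 0 ε) x := by
      simpa using (((hasDerivAt_id x).sub_const ε).ofReal_comp).hasDerivWithinAt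
    exact ((hy x hx).sub ((hlin.mul_const A₁).const_add A₀)).congr_deriv (by simp)
  have hr' : ∀ x ∈ Set.Icc (0 : ℝ) ε,
      HasDerivWithinAt (fun x => y' x - A₁) (y'' x) (Set.Icc 0 ε) x :=
    fun x hx => (hy' x hx).sub_const A₁
  obtain ⟨x₀, hx₀, hmax⟩ := isCompact_Icc.exists_isMaxOn (Set.nonempty_Icc.2 hε.le)
    (ContinuousOn.norm fun x hx => (hr x hx).continuousWithinAt)
  set M := ‖r x₀‖
  have hrM : ∀ x ∈ Set.Icc (0 : ℝ) ε, ‖r x‖ ≤ M := fun x hx => hmax hx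
  set L := ‖lam‖
  set s := Real.sqrt ε
  set a := ‖A₀‖
  set b := ‖A₁‖
  have hL : 0 ≤ L := norm_nonneg _
  have hs : 0 ≤ s := Real.sqrt_nonneg _
  have ha : 0 ≤ a := norm_nonneg _
  have hb0 : 0 ≤ b := norm_nonneg _
  have hM : 0 ≤ M := norm_nonneg _
  have hsecond : ∀ x ∈ Set.Icc (0 : ℝ) ε,
      ‖y'' x‖ ≤ (L + s) * (a + M + b * (ε - x)) := by
    intro x hx
    have hc : ‖-(Real.sqrt x : ℂ) - lam‖ ≤ L + s := by
      calc ‖-(Real.sqrt x : ℂ) - lam‖ ≤ ‖-(Real.sqrt x : ℂ)‖ + ‖lam‖ := norm_sub_le _ _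
        _ = Real.sqrt x + L := by
          rw [norm_neg, Complex.norm_real, Real.norm_of_nonneg (Real.sqrt_nonneg x)]
        _ ≤ L + s := by linarith [Real.sqrt_le_sqrt hx.2]
    have hyx : ‖y x‖ ≤ a + M + b * (ε - x) := by
      have hsplit : y x = r x + (A₀ + ((x - ε : ℝ) : ℂ) * A₁) := by simp [hr_def]
      have hlin : ‖((x - ε : ℝ) : ℂ) * A₁‖ = b * (ε - x) := by
        rw [norm_mul, Complex.norm_real, Real.norm_of_nonpos (by linarith [hx.2])]
        ring
      calc ‖y x‖ ≤ ‖r x‖ + (‖A₀‖ + ‖((x - ε : ℝ) : ℂ) * A₁‖) := by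
            rw [hsplit]
            exact (norm_add_le _ _).trans (add_le_add_right (norm_add_le _ _) _)
        _ ≤ a + M + b * (ε - x) := by rw [hlin]; linarith [hrM x hx]
    rw [hode x hx, norm_mul]
    exact mul_le_mul hc hyx (norm_nonneg _) (by positivity)
  have hfirst := norm_le_of_norm_deriv_le_of_right_eq_zero hr' (by simp [hA₁])
    (B := fun u => (L + s) * ((a + M) * u + b * (u ^ 2 / 2)))
    (B' := fun u => (L + s) * (a + M + b * u))
    (fun u => by
      have h := (((hasDerivAt_id u).const_mul (a + M)).add
        ((((hasDerivAt_id u).pow 2).div_const 2).const_mul b)).const_mul (L + s)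
      refine h.congr_deriv ?_
      simp) (by simp) hsecond
  have hzero := norm_le_of_norm_deriv_le_of_right_eq_zero hr (by simp [hr_def, hA₀])
    (B := fun u => (L + s) * ((a + M) * (u ^ 2 / 2) + b * (u ^ 3 / 6)))
    (B' := fun u => (L + s) * ((a + M) * u + b * (u ^ 2 / 2)))
    (fun u => by
      have h := (((((hasDerivAt_id u).pow 2).div_const 2).const_mul (a + M)).add
        ((((hasDerivAt_id u).pow 3).div_const 6).const_mul b)).const_mul (L + s)
      refine h.congr_deriv ?_
      simp only [id]
      push_cast
      ring) (by simp) hfirst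
  have hMle : M ≤ (L + s) * ((a + M) * (ε ^ 2 / 2) + b * (ε ^ 3 / 6)) := by
    refine (hzero x₀ hx₀).trans ?_
    have h0 : 0 ≤ ε - x₀ := by linarith [hx₀.2]
    have h1 : ε - x₀ ≤ ε := by linarith [hx₀.1]
    gcongr
  have hD : 0 < 1 - ε ^ 2 * (L + 2 / 3 * s) := by linarith
  have h0 : ‖y 0 - (A₀ - (ε : ℂ) * A₁)‖ ≤ M := by
    convert hrM 0 ⟨le_rfl, hε.le⟩ using 2
    simp [hr_def]
    ring
  refine h0.trans ?_
  rw [div_mul_eq_mul_div, le_div_iff₀ hD]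
  have e1 : 0 ≤ ε ^ 2 * M * L := by positivity
  have e2 : 0 ≤ ε ^ 2 * M * s := by positivity
  have e3 : 0 ≤ ε ^ 2 * s * a := by positivity
  have e4 : 0 ≤ ε ^ 3 * L * b := by positivity
  have e5 : 0 ≤ ε ^ 3 * s * b := by positivity
  nlinarith
end

section
/- Let λ ∈ ℂ and ε > 0 with ε²·(|λ| + (2/3)·√ε) < 1. Let y : [0,ε] → ℂ be twice continuously differentiable with y''(x) = (−√x − λ)·y(x) for all x ∈ [0,ε], and set A₀ = y(ε), A₁ = y'(ε). Then |y'(0) − (A₁ + ε·(λ + √ε)·A₀)| ≤ [ ε^{3/2} / (1 − ε²·(|λ| + (2/3)·√ε)) ] · { [ (1/2)·ε^{3/2}·(|λ| + √ε)·(|λ| + (2/3)·√ε) + 1/3 ]·|A₀| + √ε·((1/2)·|λ| + (4/15)·√ε)·|A₁| }. -/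
open Set

/-- A mean value inequality integrated backwards from the right endpoint. -/
lemma norm_le_of_norm_deriv_le_neg_deriv {a : ℝ} {f f' : ℝ → ℂ} {B b : ℝ → ℝ}
    (hf : ∀ x ∈ Icc (0 : ℝ) a, HasDerivWithinAt f (f' x) (Icc 0 a) x)
    (hB : ∀ x ∈ Icc (0 : ℝ) a, HasDerivWithinAt B (-b x) (Icc 0 a) x)
    (hend : ‖f a‖ ≤ B a) (hbound : ∀ x ∈ Icc (0 : ℝ) a, ‖f' x‖ ≤ b x) :
    ∀ x ∈ Icc (0 : ℝ) a, ‖f x‖ ≤ B x := by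
  have hmaps : MapsTo (fun t : ℝ => a - t) (Icc 0 a) (Icc 0 a) := fun t ht =>
    ⟨by linarith [ht.2], by linarith [ht.1]⟩
  have hrefl : ∀ t, HasDerivWithinAt (fun t : ℝ => a - t) (-1) (Icc 0 a) t := fun t => by
    simpa using (hasDerivWithinAt_id t (Icc 0 a)).const_sub a
  have hf_refl : ∀ t ∈ Icc (0 : ℝ) a,
      HasDerivWithinAt (fun t => f (a - t)) (-f' (a - t)) (Icc 0 a) t := fun t ht => by
    simpa [Function.comp_def] using
      (hf (a - t) (hmaps ht)).scomp t (hrefl t) hmaps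
  have hB_refl : ∀ t ∈ Icc (0 : ℝ) a,
      HasDerivWithinAt (fun t => B (a - t)) (b (a - t)) (Icc 0 a) t := fun t ht => by
    simpa [Function.comp_def] using
      (hB (a - t) (hmaps ht)).scomp t (hrefl t) hmaps
  intro x hx
  have key := image_norm_le_of_norm_deriv_right_le_deriv_boundary'
    (f := fun t => f (a - t)) (f' := fun t => -f' (a - t))
    (B := fun t => B (a - t)) (B' := fun t => b (a - t))
    (fun t ht => (hf_refl t ht).continuousWithinAt)
    (fun t ht => (hf_refl t (Ico_subset_Icc_self ht)).mono_of_mem_nhdsWithin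
      (Icc_mem_nhdsGE_of_mem ht))
    (by simpa using hend)
    (fun t ht => (hB_refl t ht).continuousWithinAt)
    (fun t ht => (hB_refl t (Ico_subset_Icc_self ht)).mono_of_mem_nhdsWithin
      (Icc_mem_nhdsGE_of_mem ht))
    (fun t ht => by simpa using hbound (a - t) (hmaps (Ico_subset_Icc_self ht)))
    (hmaps hx)
  simpa using key

lemma rpow_three_halves_eq {x : ℝ} (hx : 0 ≤ x) : x ^ ((3 : ℝ) / 2) = x * √x := by
  rw [show (3 : ℝ) / 2 = 1 + 1 / 2 by norm_num,
    Real.rpow_add_of_nonneg hx (by norm_num) (by norm_num), Real.rpow_one, Real.sqrt_eq_rpow]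

lemma hasDerivWithinAt_mul_sqrt {a x : ℝ} (hx : x ∈ Icc (0 : ℝ) a) :
    HasDerivWithinAt (fun t => t * √t) (3 / 2 * √x) (Icc 0 a) x := by
  have h := (Real.hasDerivAt_rpow_const (x := x) (p := 3 / 2)
    (Or.inr (by norm_num))).hasDerivWithinAt (s := Icc 0 a)
  rw [show (3 : ℝ) / 2 - 1 = 1 / 2 by norm_num, ← Real.sqrt_eq_rpow] at h
  exact h.congr_of_mem (fun t ht => (rpow_three_halves_eq ht.1).symm) hx

/-- The distance from a solution of `y'' = (-√x - λ) y` to its tangent line at the right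
endpoint is bounded self-consistently by its own maximum `M`. -/
lemma exists_tangent_error_bound (lam : ℂ) {ε : ℝ} (hε : 0 < ε) {y y' y'' : ℝ → ℂ}
    (hy : ∀ x ∈ Icc (0 : ℝ) ε, HasDerivWithinAt y (y' x) (Icc 0 ε) x)
    (hy' : ∀ x ∈ Icc (0 : ℝ) ε, HasDerivWithinAt y' (y'' x) (Icc 0 ε) x)
    (hode : ∀ x ∈ Icc (0 : ℝ) ε, y'' x = (-(√x : ℂ) - lam) * y x) :
    ∃ M : ℝ, 0 ≤ M ∧ (∀ x ∈ Icc (0 : ℝ) ε, ‖y x - (y ε + ((x - ε : ℝ) : ℂ) * y' ε)‖ ≤ M) ∧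
      M ≤ (‖lam‖ + √ε) * ((M + ‖y ε‖) * (ε ^ 2 / 2) + ‖y' ε‖ * (ε ^ 3 / 6)) := by
  set u : ℝ → ℂ := fun x => y x - (y ε + ((x - ε : ℝ) : ℂ) * y' ε) with hu_def
  have hu : ∀ x ∈ Icc (0 : ℝ) ε, HasDerivWithinAt u (y' x - y' ε) (Icc 0 ε) x := fun x hx => by
    have hlin : HasDerivWithinAt (fun x : ℝ => ((x - ε : ℝ) : ℂ)) 1 (Icc 0 ε) x := by
      simpa using ((hasDerivAt_id x).sub_const ε).ofReal_comp.hasDerivWithinAt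
    exact ((hy x hx).sub ((hlin.mul_const (y' ε)).const_add (y ε))).congr_deriv (by ring)
  obtain ⟨x₀, hx₀, hmax⟩ := isCompact_Icc.exists_isMaxOn ⟨0, left_mem_Icc.2 hε.le⟩
    (f := fun x => ‖u x‖) (fun x hx => ((hu x hx).continuousWithinAt).norm)
  have hM : ∀ x ∈ Icc (0 : ℝ) ε, ‖u x‖ ≤ ‖u x₀‖ := fun x hx => hmax hx
  refine ⟨‖u x₀‖, norm_nonneg _, hM, ?_⟩
  set M := ‖u x₀‖
  have hM0 : 0 ≤ M := norm_nonneg _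
  have hsecond : ∀ x ∈ Icc (0 : ℝ) ε,
      ‖y'' x‖ ≤ (‖lam‖ + √ε) * ((M + ‖y ε‖) + ‖y' ε‖ * (ε - x)) := fun x hx => by
    rw [hode x hx, norm_mul]
    gcongr
    · calc ‖-(√x : ℂ) - lam‖ ≤ ‖-(√x : ℂ)‖ + ‖lam‖ := norm_sub_le _ _
        _ = √x + ‖lam‖ := by
          rw [norm_neg, Complex.norm_real, Real.norm_of_nonneg (Real.sqrt_nonneg x)]
        _ ≤ ‖lam‖ + √ε := by linarith [Real.sqrt_le_sqrt hx.2]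
    · calc ‖y x‖ = ‖u x + y ε + ((x - ε : ℝ) : ℂ) * y' ε‖ := by
            congr 1; simp only [hu_def]; ring
        _ ≤ ‖u x‖ + ‖y ε‖ + ‖((x - ε : ℝ) : ℂ) * y' ε‖ := norm_add₃_le
        _ = ‖u x‖ + ‖y ε‖ + ‖y' ε‖ * (ε - x) := by
          rw [norm_mul, Complex.norm_real, Real.norm_of_nonpos (by linarith [hx.2])]; ring
        _ ≤ _ := by linarith [hM x hx]
  have hpow : ∀ (n : ℕ) (x : ℝ), HasDerivAt (fun t : ℝ => (ε - t) ^ (n + 1))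
      (-((n + 1) * (ε - x) ^ n)) x := fun n x => by
    exact (((hasDerivAt_id x).const_sub ε).pow (n + 1)).congr_deriv (by simp)
  have hfirst := norm_le_of_norm_deriv_le_neg_deriv
    (B := fun x => (‖lam‖ + √ε) * ((M + ‖y ε‖) * (ε - x) ^ (0 + 1)
      + ‖y' ε‖ / 2 * (ε - x) ^ (1 + 1)))
    (fun x hx => (hy' x hx).sub_const (y' ε))
    (fun x _ => (((((hpow 0 x).const_mul (M + ‖y ε‖)).add
      ((hpow 1 x).const_mul (‖y' ε‖ / 2))).const_mul (‖lam‖ + √ε)).congr_deriv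
        (by push_cast; ring)).hasDerivWithinAt)
    (by simp) hsecond
  have hzero := norm_le_of_norm_deriv_le_neg_deriv
    (B := fun x => (‖lam‖ + √ε) * ((M + ‖y ε‖) / 2 * (ε - x) ^ (1 + 1)
      + ‖y' ε‖ / 6 * (ε - x) ^ (2 + 1)))
    hu
    (fun x _ => (((((hpow 1 x).const_mul ((M + ‖y ε‖) / 2)).add
      ((hpow 2 x).const_mul (‖y' ε‖ / 6))).const_mul (‖lam‖ + √ε)).congr_deriv
        (by push_cast; ring)).hasDerivWithinAt)
    (by simp [hu_def]) hfirst x₀ hx₀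
  have hle : ε - x₀ ≤ ε := by linarith [hx₀.1]
  have hnn : 0 ≤ ε - x₀ := by linarith [hx₀.2]
  calc M ≤ _ := hzero
    _ ≤ (‖lam‖ + √ε) * ((M + ‖y ε‖) / 2 * ε ^ (1 + 1) + ‖y' ε‖ / 6 * ε ^ (2 + 1)) := by gcongr
    _ = _ := by ring

/-- If `y` stays within `M` of its tangent line at `ε`, then `y' 0` is close to the value obtained
by integrating `(-√x - λ)` against that tangent line. -/
lemma norm_deriv_zero_sub_le (lam : ℂ) {ε M : ℝ} (hε : 0 < ε) {y y' y'' : ℝ → ℂ}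
    (hy' : ∀ x ∈ Icc (0 : ℝ) ε, HasDerivWithinAt y' (y'' x) (Icc 0 ε) x)
    (hode : ∀ x ∈ Icc (0 : ℝ) ε, y'' x = (-(√x : ℂ) - lam) * y x)
    (hM : ∀ x ∈ Icc (0 : ℝ) ε, ‖y x - (y ε + ((x - ε : ℝ) : ℂ) * y' ε)‖ ≤ M) :
    ‖y' 0 - y' ε - (2 / 3 * (ε * √ε : ℝ) + lam * ε) * y ε
        + (4 / 15 * (ε * (ε * √ε) : ℝ) + lam * ε ^ 2 / 2) * y' ε‖
      ≤ M * (‖lam‖ * ε + 2 / 3 * (ε * √ε)) := by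
  set P : ℝ → ℂ := fun x => -(2 / 3 * (x * √x : ℝ) + lam * x) * y ε
    - (2 / 5 * (x * (x * √x) : ℝ) + lam * (x * x : ℝ) / 2
      - ε * (2 / 3 * (x * √x : ℝ) + lam * x)) * y' ε with hP_def
  have hP : ∀ x ∈ Icc (0 : ℝ) ε, HasDerivWithinAt P
      ((-(√x : ℂ) - lam) * (y ε + ((x - ε : ℝ) : ℂ) * y' ε)) (Icc 0 ε) x := fun x hx => by
    have hid := hasDerivWithinAt_id x (Icc 0 ε)
    have h₁ := hid.ofReal_comp.const_mul lam
    have h₂ := (hid.mul hid).ofReal_comp.const_mul lam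
    have h₃ := (hasDerivWithinAt_mul_sqrt hx).ofReal_comp.const_mul (2 / 3 : ℂ)
    have h₅ := (hid.mul (hasDerivWithinAt_mul_sqrt hx)).ofReal_comp.const_mul (2 / 5 : ℂ)
    refine (((h₃.add h₁).neg.mul_const (y ε)).sub
      (((h₅.add (h₂.div_const 2)).sub ((h₃.add h₁).const_mul (ε : ℂ))).mul_const
        (y' ε))).congr_deriv ?_
    simp only [id]
    push_cast
    ring
  have key := norm_le_of_norm_deriv_le_neg_deriv
    (f := fun x => y' x - y' ε - (P x - P ε))
    (B := fun x => M * (‖lam‖ * (ε - x) + 2 / 3 * (ε * √ε - x * √x)))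
    (b := fun x => M * (‖lam‖ + √x))
    (fun x hx => ((hy' x hx).sub_const (y' ε)).sub ((hP x hx).sub_const (P ε)))
    (fun x hx => (((((hasDerivWithinAt_id x (Icc 0 ε)).const_sub ε).const_mul ‖lam‖).add
      (((hasDerivWithinAt_mul_sqrt hx).const_sub (ε * √ε)).const_mul (2 / 3))).const_mul
        M).congr_deriv (by ring))
    (by simp)
    (fun x hx => by
      rw [hode x hx, ← mul_sub, norm_mul, mul_comm]
      gcongr
      · exact (norm_nonneg _).trans (hM x hx)
      · exact hM x hx
      · calc ‖-(√x : ℂ) - lam‖ ≤ ‖-(√x : ℂ)‖ + ‖lam‖ := norm_sub_le _ _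
          _ = ‖lam‖ + √x := by
            rw [norm_neg, Complex.norm_real, Real.norm_of_nonneg (Real.sqrt_nonneg x), add_comm])
    0 (left_mem_Icc.2 hε.le)
  convert key using 2
  · simp only [hP_def]
    push_cast
    ring
  · ring

/-- Enclosure for `y'(0)` for the equation `y'' = (−√x − λ)·y` on `[0,ε]`
in terms of `A₀ = y(ε)`, `A₁ = y'(ε)`, provided `ε²(|λ| + (2/3)√ε) < 1`. -/
theorem sqrt_potential_endpoint_bound_y'
    (lam : ℂ) (ε : ℝ) (hε : 0 < ε)
    (hb : ε ^ 2 * (‖lam‖ + (2 / 3) * Real.sqrt ε) < 1)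
    (y y' y'' : ℝ → ℂ)
    (hy : ∀ x ∈ Set.Icc (0:ℝ) ε, HasDerivWithinAt y (y' x) (Set.Icc 0 ε) x)
    (hy' : ∀ x ∈ Set.Icc (0:ℝ) ε, HasDerivWithinAt y' (y'' x) (Set.Icc 0 ε) x)
    (hy'' : ContinuousOn y'' (Set.Icc 0 ε))
    (hode : ∀ x ∈ Set.Icc (0:ℝ) ε,
      y'' x = (-(Real.sqrt x : ℂ) - lam) * y x)
    (A₀ A₁ : ℂ) (hA₀ : A₀ = y ε) (hA₁ : A₁ = y' ε) :
    ‖y' 0 - (A₁ + (ε : ℂ) * (lam + (Real.sqrt ε : ℂ)) * A₀)‖ ≤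
      (ε ^ ((3:ℝ)/2) / (1 - ε ^ 2 * (‖lam‖ + (2 / 3) * Real.sqrt ε))) *
        (((1 / 2) * ε ^ ((3:ℝ)/2) * (‖lam‖ + Real.sqrt ε) *
            (‖lam‖ + (2 / 3) * Real.sqrt ε) + 1 / 3) * ‖A₀‖ +
          Real.sqrt ε * ((1 / 2) * ‖lam‖ + (4 / 15) * Real.sqrt ε) * ‖A₁‖) := by
  subst hA₀ hA₁
  obtain ⟨M, hM0, hM, hMle⟩ := exists_tangent_error_bound lam hε hy hy' hode
  have hint := norm_deriv_zero_sub_le lam hε hy' hode hM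
  rw [rpow_three_halves_eq hε.le]
  obtain ⟨s, hs, rfl⟩ : ∃ s : ℝ, 0 < s ∧ ε = s ^ 2 :=
    ⟨√ε, Real.sqrt_pos.2 hε, (Real.sq_sqrt hε.le).symm⟩
  rw [Real.sqrt_sq hs.le] at *
  have htri : ‖y' 0 - (y' (s ^ 2) + ((s ^ 2 : ℝ) : ℂ) * (lam + (s : ℂ)) * y (s ^ 2))‖ ≤
      M * (‖lam‖ * s ^ 2 + 2 / 3 * (s ^ 2 * s)) + s ^ 3 / 3 * ‖y (s ^ 2)‖
        + (4 / 15 * s ^ 5 + ‖lam‖ * s ^ 4 / 2) * ‖y' (s ^ 2)‖ := by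
    have hcubic : ‖((s ^ 3 / 3 : ℝ) : ℂ)‖ = s ^ 3 / 3 := by
      rw [Complex.norm_real, Real.norm_of_nonneg (by positivity)]
    have hcoef : ‖((4 / 15 * s ^ 5 : ℝ) : ℂ) + lam * ((s ^ 4 / 2 : ℝ) : ℂ)‖ ≤
        4 / 15 * s ^ 5 + ‖lam‖ * s ^ 4 / 2 := by
      refine (norm_add_le _ _).trans_eq ?_
      rw [norm_mul, Complex.norm_real, Complex.norm_real, Real.norm_of_nonneg (by positivity),
        Real.norm_of_nonneg (by positivity)]
      ring
    refine le_trans (le_of_eq ?_) ((norm_sub_le _ _).trans (add_le_add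
      ((norm_sub_le _ (((s ^ 3 / 3 : ℝ) : ℂ) * y (s ^ 2))).trans
        (add_le_add hint (by rw [norm_mul, hcubic])))
      ((norm_mul_le (((4 / 15 * s ^ 5 : ℝ) : ℂ) + lam * ((s ^ 4 / 2 : ℝ) : ℂ))
        (y' (s ^ 2))).trans (mul_le_mul_of_nonneg_right hcoef (norm_nonneg _)))))
    congr 1
    push_cast
    ring
  refine htri.trans ?_
  have hL := norm_nonneg lam
  have h₀ := norm_nonneg (y (s ^ 2))
  have h₁ := norm_nonneg (y' (s ^ 2))
  generalize ‖lam‖ = L at *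
  generalize ‖y (s ^ 2)‖ = a₀ at *
  generalize ‖y' (s ^ 2)‖ = a₁ at *
  rw [div_mul_eq_mul_div (s ^ 2 * s), le_div_iff₀ (by linarith)]
  have hMq : M * (1 - (s ^ 2) ^ 2 * (L + 2 / 3 * s)) ≤
      (L + s) * (a₀ * (s ^ 4 / 2) + a₁ * (s ^ 6 / 6)) := by
    have : 0 ≤ M * (s ^ 4 * (L / 2 + s / 6)) := by positivity
    linear_combination hMle + this
  have hscaled := mul_le_mul_of_nonneg_left hMq
    (show 0 ≤ s ^ 2 * (L + 2 / 3 * s) by positivity)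
  have hslack₁ : 0 ≤ s ^ 8 * (L + 2 / 3 * s) * (L / 3 + s / 10) * a₁ := by positivity
  have hslack₀ : 0 ≤ (s ^ 2) ^ 2 * (L + 2 / 3 * s) * (s ^ 3 / 3 * a₀) := by positivity
  linear_combination hscaled + hslack₁ + hslack₀
end

section
/- Let λ ∈ ℂ and ε > 0 with ε²·(|λ| + (2/5)·ε^{3/2}) < 1. Let y : [0,ε] → ℂ be twice continuously differentiable with y''(x) = (−x^{3/2} − λ)·y(x) for all x ∈ [0,ε], and set A₀ = y(ε), A₁ = y'(ε). Then |y(0) − (A₀ − ε·A₁)| ≤ [ ε² / (1 − ε²·(|λ| + (2/5)·ε^{3/2})) ] · { ((1/2)·|λ| + (11/10)·ε^{3/2})·|A₀| + ε·((1/2)·|λ| + (4/35)·ε^{3/2})·|A₁| }. -/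
open Set

/-- An explicit primitive of `t * (L + t ^ (3/2)) * (C + (ε - t) * b)`. -/
lemma hasDerivAt_threeHalves_majorant (L C b ε t : ℝ) (ht : 0 ≤ t) :
    HasDerivAt (fun t : ℝ => L * (C * t ^ 2 / 2 + b * (ε * t ^ 2 / 2 - t ^ 3 / 3)) +
        ((C + ε * b) * (2 / 7) * t ^ 2 - b * (2 / 9) * t ^ 3) * t ^ ((3 : ℝ) / 2))
      (t * (L + t ^ ((3 : ℝ) / 2)) * (C + (ε - t) * b)) t := by
  have hs : HasDerivAt (fun t : ℝ => t ^ ((3 : ℝ) / 2))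
      ((3 : ℝ) / 2 * t ^ ((3 : ℝ) / 2 - 1)) t :=
    Real.hasDerivAt_rpow_const (Or.inr (by norm_num))
  have hmul : t * t ^ ((3 : ℝ) / 2 - 1) = t ^ ((3 : ℝ) / 2) := by
    rw [mul_comm, ← Real.rpow_add_one' ht (by norm_num)]
    norm_num
  have h2 : HasDerivAt (fun t : ℝ => t ^ 2) (2 * t) t := by
    simpa using hasDerivAt_pow 2 t
  have h3 : HasDerivAt (fun t : ℝ => t ^ 3) (3 * t ^ 2) t := by
    simpa using hasDerivAt_pow 3 t
  have h := (((((h2.const_mul C).div_const 2).add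
    ((((h2.const_mul ε).div_const 2).sub (h3.div_const 3)).const_mul b)).const_mul L)).add
    (((h2.const_mul ((C + ε * b) * (2 / 7))).sub (h3.const_mul (b * (2 / 9)))).mul hs)
  refine h.congr_deriv ?_
  simp only [Pi.sub_apply]
  linear_combination ((C + ε * b) * (2 / 7) * t - b * (2 / 9) * t ^ 2) * (3 / 2) * hmul

/-- If `‖y''‖ ≤ (L + t ^ (3/2)) * (C + (ε - t) * b)` on `[0, ε]`, then `y` differs from its tangent
at `ε` by at most the integral of `t` times this bound. -/
lemma norm_sub_tangent_le_of_norm_second_deriv_le {y y' y'' : ℝ → ℂ} {ε L C b x : ℝ}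
    (hL : 0 ≤ L) (hC : 0 ≤ C) (hb : 0 ≤ b)
    (hy : ∀ x ∈ Icc (0 : ℝ) ε, HasDerivWithinAt y (y' x) (Icc 0 ε) x)
    (hy' : ∀ x ∈ Icc (0 : ℝ) ε, HasDerivWithinAt y' (y'' x) (Icc 0 ε) x)
    (hbound : ∀ t ∈ Icc (0 : ℝ) ε, ‖y'' t‖ ≤ (L + t ^ ((3 : ℝ) / 2)) * (C + (ε - t) * b))
    (hx : x ∈ Icc (0 : ℝ) ε) :
    ‖y x - (y ε + ((x : ℂ) - ε) * y' ε)‖ ≤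
      ε ^ 2 * (L * (C / 2 + ε * b / 6) + (C * (2 / 7) + ε * b * (4 / 63)) * ε ^ ((3 : ℝ) / 2)) := by
  obtain ⟨hx0, hxε⟩ := hx
  set P : ℝ → ℝ := fun t => L * (C * t ^ 2 / 2 + b * (ε * t ^ 2 / 2 - t ^ 3 / 3)) +
    ((C + ε * b) * (2 / 7) * t ^ 2 - b * (2 / 9) * t ^ 3) * t ^ ((3 : ℝ) / 2) with hP
  set h : ℝ → ℂ := fun t => y t - ((t : ℂ) - x) * (y' t - y' ε) - (t : ℂ) * y' ε with hh
  have hder : ∀ t ∈ Icc x ε, HasDerivWithinAt h (-(((t : ℂ) - x) * y'' t)) (Icc 0 ε) t := by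
    intro t ht
    have ht' : t ∈ Icc 0 ε := ⟨hx0.trans ht.1, ht.2⟩
    have hid : HasDerivWithinAt (fun t : ℝ => (t : ℂ)) 1 (Icc 0 ε) t :=
      (Complex.ofRealCLM.hasDerivAt (x := t)).hasDerivWithinAt
    refine (((hy t ht').sub ((hid.sub_const (x : ℂ)).mul ((hy' t ht').sub_const (y' ε)))).sub
      (hid.mul_const (y' ε))).congr_deriv ?_
    ring
  have key : ∀ ⦃t⦄, t ∈ Icc x ε → ‖h t - h x‖ ≤ P t - P x := by
    refine image_norm_le_of_norm_deriv_right_le_deriv_boundary'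
      (f' := fun t => -(((t : ℂ) - x) * y'' t))
      (B' := fun t => t * (L + t ^ ((3 : ℝ) / 2)) * (C + (ε - t) * b)) ?_ ?_ (by simp) ?_ ?_ ?_
    · intro t ht
      exact (((hder t ht).continuousWithinAt).mono (Icc_subset_Icc_left hx0)).sub
        continuousWithinAt_const
    · intro t ht
      refine ((hder t ⟨ht.1, ht.2.le⟩).sub_const (h x)).mono_of_mem_nhdsWithin ?_
      exact Filter.mem_of_superset (Icc_mem_nhdsGE ht.2) (Icc_subset_Icc_left (hx0.trans ht.1))
    · intro t ht
      exact ((hasDerivAt_threeHalves_majorant L C b ε t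
        (hx0.trans ht.1)).sub_const (P x)).continuousAt.continuousWithinAt
    · intro t ht
      exact ((hasDerivAt_threeHalves_majorant L C b ε t
        (hx0.trans ht.1)).sub_const (P x)).hasDerivWithinAt
    · intro t ht
      have ht0 : 0 ≤ t := hx0.trans ht.1
      have hn : ‖(t : ℂ) - x‖ ≤ t := by
        rw [← Complex.ofReal_sub, Complex.norm_real, Real.norm_of_nonneg (sub_nonneg.2 ht.1)]
        linarith
      rw [norm_neg, norm_mul, mul_assoc]
      exact mul_le_mul hn (hbound t ⟨ht0, ht.2.le⟩) (norm_nonneg _) ht0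
  have hPx : 0 ≤ P x := by
    have hx3 : x ^ 3 ≤ ε * x ^ 2 := by nlinarith [mul_nonneg (sq_nonneg x) (sub_nonneg.2 hxε)]
    have hs : 0 ≤ x ^ ((3 : ℝ) / 2) := by positivity
    have hεx : 0 ≤ ε * x ^ 2 := mul_nonneg (hx0.trans hxε) (sq_nonneg x)
    have h1 : 0 ≤ ε * x ^ 2 / 2 - x ^ 3 / 3 := by linarith
    have h2 : 0 ≤ (C + ε * b) * (2 / 7) * x ^ 2 - b * (2 / 9) * x ^ 3 := by
      nlinarith [mul_nonneg hb (sub_nonneg.2 hx3), mul_nonneg hb hεx,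
        mul_nonneg hC (sq_nonneg x)]
    have h3 := mul_nonneg h2 hs
    have h4 := mul_nonneg hb h1
    simp only [hP]
    positivity
  have hε := key (right_mem_Icc.2 hxε)
  calc ‖y x - (y ε + ((x : ℂ) - ε) * y' ε)‖ = ‖h ε - h x‖ := by
        rw [norm_sub_rev (h ε)]
        congr 1
        simp only [hh]
        ring
    _ ≤ P ε := by linarith
    _ = _ := by
        simp only [hP]
        ring

/-- Enclosure for `y(0)` for the equation `y'' = (−x^{3/2} − λ)·y` on `[0,ε]`
in terms of `A₀ = y(ε)`, `A₁ = y'(ε)`, provided `ε²(|λ| + (2/5)ε^{3/2}) < 1`. -/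
theorem three_halves_potential_endpoint_bound_y
    (lam : ℂ) (ε : ℝ) (hε : 0 < ε)
    (hb : ε ^ 2 * (‖lam‖ + (2 / 5) * ε ^ ((3:ℝ)/2)) < 1)
    (y y' y'' : ℝ → ℂ)
    (hy : ∀ x ∈ Set.Icc (0:ℝ) ε, HasDerivWithinAt y (y' x) (Set.Icc 0 ε) x)
    (hy' : ∀ x ∈ Set.Icc (0:ℝ) ε, HasDerivWithinAt y' (y'' x) (Set.Icc 0 ε) x)
    (hy'' : ContinuousOn y'' (Set.Icc 0 ε))
    (hode : ∀ x ∈ Set.Icc (0:ℝ) ε,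
      y'' x = (-((x ^ ((3:ℝ)/2) : ℝ) : ℂ) - lam) * y x)
    (A₀ A₁ : ℂ) (hA₀ : A₀ = y ε) (hA₁ : A₁ = y' ε) :
    ‖y 0 - (A₀ - (ε : ℂ) * A₁)‖ ≤
      (ε ^ 2 / (1 - ε ^ 2 * (‖lam‖ + (2 / 5) * ε ^ ((3:ℝ)/2)))) *
        (((1 / 2) * ‖lam‖ + (11 / 10) * ε ^ ((3:ℝ)/2)) * ‖A₀‖ +
          ε * ((1 / 2) * ‖lam‖ + (4 / 35) * ε ^ ((3:ℝ)/2)) * ‖A₁‖) := by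
  subst hA₀ hA₁
  set u : ℝ → ℂ := fun x => y x - (y ε + ((x : ℂ) - ε) * y' ε) with hu
  have hcont : ContinuousOn (fun x => ‖u x‖) (Icc 0 ε) := by
    have hyc : ContinuousOn y (Icc 0 ε) := fun x hx => (hy x hx).continuousWithinAt
    exact (hyc.sub (by fun_prop)).norm
  obtain ⟨x₀, hx₀, hmax⟩ := isCompact_Icc.exists_isMaxOn (nonempty_Icc.2 hε.le) hcont
  set M := ‖u x₀‖ with hM
  have hM0 : 0 ≤ M := norm_nonneg _
  have hmax' : ∀ x ∈ Icc 0 ε, ‖u x‖ ≤ M := fun x hx => hmax hx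
  have hbound : ∀ t ∈ Icc (0 : ℝ) ε,
      ‖y'' t‖ ≤ (‖lam‖ + t ^ ((3 : ℝ) / 2)) * (‖y ε‖ + M + (ε - t) * ‖y' ε‖) := by
    intro t ht
    have hs : 0 ≤ t ^ ((3 : ℝ) / 2) := Real.rpow_nonneg ht.1 _
    rw [hode t ht, norm_mul]
    refine mul_le_mul ?_ ?_ (norm_nonneg _) (by positivity)
    · refine (norm_sub_le _ _).trans ?_
      rw [norm_neg, Complex.norm_real, Real.norm_of_nonneg hs, add_comm]
    · have hdecomp : y t = y ε + u t + ((t : ℂ) - ε) * y' ε := by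
        simp only [hu]
        ring
      have hn : ‖(t : ℂ) - ε‖ = ε - t := by
        rw [norm_sub_rev, ← Complex.ofReal_sub, Complex.norm_real,
          Real.norm_of_nonneg (sub_nonneg.2 ht.2)]
      rw [hdecomp]
      refine norm_add₃_le.trans ?_
      rw [norm_mul, hn]
      gcongr
      exact hmax' t ht
  have hMle := norm_sub_tangent_le_of_norm_second_deriv_le (norm_nonneg lam)
    (add_nonneg (norm_nonneg _) hM0) (norm_nonneg (y' ε)) hy hy' hbound hx₀
  change M ≤ _ at hMle
  have h0 : y 0 - (y ε - (ε : ℂ) * y' ε) = u 0 := by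
    simp only [hu, Complex.ofReal_zero]
    ring
  rw [h0]
  refine (hmax' 0 (left_mem_Icc.2 hε.le)).trans ?_
  rw [div_mul_eq_mul_div, le_div_iff₀ (by linarith)]
  have hs : 0 ≤ ε ^ ((3 : ℝ) / 2) := Real.rpow_nonneg hε.le _
  generalize ε ^ ((3 : ℝ) / 2) = s at *
  have r1 : 0 ≤ ε ^ 2 * ‖lam‖ * M := by positivity
  have r2 : 0 ≤ ε ^ 2 * s * M := by positivity
  have r3 : 0 ≤ ε ^ 2 * s * ‖y ε‖ := by positivity
  have r4 : 0 ≤ ε ^ 3 * ‖lam‖ * ‖y' ε‖ := by positivity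
  have r5 : 0 ≤ ε ^ 3 * s * ‖y' ε‖ := by positivity
  linarith
end

section
/- Let λ ∈ ℂ and ε > 0 with ε²·(|λ| + (2/5)·ε^{3/2}) < 1. Let y : [0,ε] → ℂ be twice continuously differentiable with y''(x) = (−x^{3/2} − λ)·y(x) for all x ∈ [0,ε], and set A₀ = y(ε), A₁ = y'(ε). Then |y'(0) − (A₁ + ε·(λ + ε^{3/2})·A₀)| ≤ [ ε² / (1 − ε²·(|λ| + (2/5)·ε^{3/2})) ] · { [ (1/2)·ε·(|λ| + ε^{3/2})·(|λ| + (2/5)·ε^{3/2}) + (3/5)·√ε ]·|A₀| + ((1/2)·|λ| + (4/35)·ε^{3/2})·|A₁| }. -/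
open Set in
/-- If the derivative of `h` is dominated in norm by that of a real function `φ` on `[a, b]`, then
the increment of `h` over any `[x, b] ⊆ [a, b]` is dominated by the increment of `φ` over
`[a, b]`. -/
lemma norm_sub_le_of_norm_deriv_le_deriv {E : Type*} [NormedAddCommGroup E] [NormedSpace ℝ E]
    {a b x : ℝ} {h h' : ℝ → E} {φ φ' : ℝ → ℝ}
    (hh : ∀ t ∈ Icc a b, HasDerivWithinAt h (h' t) (Icc a b) t)
    (hφ : ∀ t, HasDerivAt φ (φ' t) t)
    (hle : ∀ t ∈ Icc a b, ‖h' t‖ ≤ φ' t) (hx : x ∈ Icc a b) :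
    ‖h b - h x‖ ≤ φ b - φ a := by
  have increment : ∀ c d, a ≤ c → c ≤ d → d ≤ b → ‖h d - h c‖ ≤ φ d - φ c := by
    intro c d hac hcd hdb
    have hsub : Icc c d ⊆ Icc a b := Icc_subset_Icc hac hdb
    refine image_norm_le_of_norm_deriv_right_le_deriv_boundary (f := fun t => h t - h c)
      (f' := h') (B := fun t => φ t - φ c) (B' := φ') ?_ ?_ ?_ ?_ ?_ (right_mem_Icc.2 hcd)
    · exact fun t ht => (((hh t (hsub ht)).continuousWithinAt).mono hsub).sub
        continuousWithinAt_const
    · intro t ht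
      refine HasDerivWithinAt.sub_const _ ?_
      exact (hh t (hsub (Ico_subset_Icc_self ht))).mono_of_mem_nhdsWithin
        (Icc_mem_nhdsGE_of_mem ⟨hac.trans ht.1, ht.2.trans_le hdb⟩)
    · simp
    · exact fun t => (hφ t).sub_const _
    · exact fun t ht => hle t (hsub (Ico_subset_Icc_self ht))
  have h₁ := increment x b hx.1 hx.2 le_rfl
  have h₂ := (norm_nonneg _).trans (increment a x le_rfl hx.1 hx.2)
  linarith

/-- Enclosure for `y'(0)` for the equation `y'' = (−x^{3/2} − λ)·y` on `[0,ε]`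
in terms of `A₀ = y(ε)`, `A₁ = y'(ε)`, provided `ε²(|λ| + (2/5)ε^{3/2}) < 1`. -/
theorem three_halves_potential_endpoint_bound_y'
    (lam : ℂ) (ε : ℝ) (hε : 0 < ε)
    (hb : ε ^ 2 * (‖lam‖ + (2 / 5) * ε ^ ((3:ℝ)/2)) < 1)
    (y y' y'' : ℝ → ℂ)
    (hy : ∀ x ∈ Set.Icc (0:ℝ) ε, HasDerivWithinAt y (y' x) (Set.Icc 0 ε) x)
    (hy' : ∀ x ∈ Set.Icc (0:ℝ) ε, HasDerivWithinAt y' (y'' x) (Set.Icc 0 ε) x)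
    (hy'' : ContinuousOn y'' (Set.Icc 0 ε))
    (hode : ∀ x ∈ Set.Icc (0:ℝ) ε,
      y'' x = (-((x ^ ((3:ℝ)/2) : ℝ) : ℂ) - lam) * y x)
    (A₀ A₁ : ℂ) (hA₀ : A₀ = y ε) (hA₁ : A₁ = y' ε) :
    ‖y' 0 - (A₁ + (ε : ℂ) * (lam + ((ε ^ ((3:ℝ)/2) : ℝ) : ℂ)) * A₀)‖ ≤
      (ε ^ 2 / (1 - ε ^ 2 * (‖lam‖ + (2 / 5) * ε ^ ((3:ℝ)/2)))) *
        (((1 / 2) * ε * (‖lam‖ + ε ^ ((3:ℝ)/2)) *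
            (‖lam‖ + (2 / 5) * ε ^ ((3:ℝ)/2)) + (3 / 5) * Real.sqrt ε) * ‖A₀‖ +
          ((1 / 2) * ‖lam‖ + (4 / 35) * ε ^ ((3:ℝ)/2)) * ‖A₁‖) := by
  subst hA₀ hA₁
  set Q : ℝ := ε ^ ((3:ℝ)/2) with hQ
  set L : ℝ := ‖lam‖ with hL
  have hL0 : 0 ≤ L := norm_nonneg _
  have hQ0 : 0 ≤ Q := Real.rpow_nonneg hε.le _
  have hεQ : ε * Q = ε ^ 2 * √ε := by
    rw [hQ, Real.sqrt_eq_rpow, ← Real.rpow_one_add' hε.le (by norm_num),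
      ← Real.rpow_natCast ε 2, ← Real.rpow_add hε]
    norm_num
  have hpow₅ : ∀ t : ℝ, 0 ≤ t → t ^ ((5:ℝ)/2) = t * t ^ ((3:ℝ)/2) := by
    intro t ht
    rw [← Real.rpow_one_add' ht (by norm_num)]
    norm_num
  have hpow₇ : ε ^ ((7:ℝ)/2) = ε ^ 2 * Q := by
    rw [hQ, ← Real.rpow_natCast ε 2, ← Real.rpow_add hε]
    norm_num
  let g : ℝ → ℂ := fun x => y' ε + ((ε - x : ℝ) : ℂ) * ((lam + (Q : ℂ)) * y ε)
  have hg : ∀ x, HasDerivAt g (-((lam + (Q : ℂ)) * y ε)) x := by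
    intro x
    have h := ((((hasDerivAt_id x).const_sub ε).ofReal_comp).mul_const
      ((lam + (Q : ℂ)) * y ε)).const_add (y' ε)
    exact h.congr_deriv (by simp)
  have hd : ∀ x ∈ Set.Icc (0:ℝ) ε, HasDerivWithinAt (fun t => y' t - g t)
      (y'' x + (lam + (Q : ℂ)) * y ε) (Set.Icc 0 ε) x := by
    intro x hx
    exact ((hy' x hx).sub (hg x).hasDerivWithinAt).congr_deriv (by ring)
  obtain ⟨x₀, hx₀, hmax⟩ := isCompact_Icc.exists_isMaxOn (Set.nonempty_Icc.2 hε.le)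
    (f := fun t => ‖y' t - g t‖) (fun x hx => (hd x hx).continuousWithinAt.norm)
  set N := ‖y' x₀ - g x₀‖ with hN
  have hN0 : 0 ≤ N := norm_nonneg _
  have hmax' : ∀ x ∈ Set.Icc (0:ℝ) ε, ‖y' x - g x‖ ≤ N := fun x hx => hmax hx
  have hK : ‖(lam + (Q : ℂ)) * y ε‖ ≤ (L + Q) * ‖y ε‖ := by
    rw [norm_mul]
    gcongr
    simpa [abs_of_nonneg hQ0] using norm_add_le lam (Q : ℂ)
  set K := (L + Q) * ‖y ε‖ with hKdef
  set M := N * ε + K * ε ^ 2 / 2 with hM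
  -- the linear approximation of `y` has error at most `M`
  have hyM : ∀ x ∈ Set.Icc (0:ℝ) ε, ‖y x - (y ε - ((ε - x : ℝ) : ℂ) * y' ε)‖ ≤ M := by
    intro x hx
    have key := norm_sub_le_of_norm_deriv_le_deriv (a := 0) (b := ε) (x := x)
      (h := fun t => y t - (t : ℂ) * y' ε) (h' := fun t => y' t - y' ε)
      (φ := fun t => N * t - K * (ε - t) ^ 2 / 2) (φ' := fun t => N + K * (ε - t)) ?_ ?_ ?_ hx
    · rw [norm_sub_rev]
      convert key using 1
      · congr 1
        push_cast
        ring
      · rw [hM]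
        ring
    · intro t ht
      have h := ((hasDerivAt_id t).ofReal_comp).mul_const (y' ε)
      exact ((hy t ht).sub h.hasDerivWithinAt).congr_deriv (by simp)
    · intro t
      have h := ((hasDerivAt_id t).const_mul N).sub
        ((((((hasDerivAt_id t).const_sub ε).pow 2).const_mul K).div_const 2))
      refine h.congr_deriv ?_
      simp
      ring
    · intro t ht
      have hsplit : y' t - y' ε =
          (y' t - g t) + ((ε - t : ℝ) : ℂ) * ((lam + (Q : ℂ)) * y ε) := by
        simp only [g]
        ring
      have ht' : 0 ≤ ε - t := sub_nonneg.2 ht.2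
      rw [hsplit]
      refine (norm_add_le _ _).trans (add_le_add (hmax' t ht) ?_)
      rw [norm_mul, Complex.norm_real, Real.norm_of_nonneg ht', mul_comm]
      gcongr
  have hM0 : 0 ≤ M := by positivity
  have hNM : N ≤ ε * (L + 2 / 5 * Q) * M + ε ^ 2 * (3 / 5 * √ε * ‖y ε‖ +
      (1 / 2 * L + 4 / 35 * Q) * ‖y' ε‖) := by
    have key := norm_sub_le_of_norm_deriv_le_deriv (a := 0) (b := ε) (x := x₀)
      (φ := fun t => (2 / 5 * t ^ ((5:ℝ)/2) + L * t) * (M + ε * ‖y' ε‖)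
        - (2 / 7 * t ^ ((7:ℝ)/2) + L * t ^ 2 / 2) * ‖y' ε‖
        + (Q * t - 2 / 5 * t ^ ((5:ℝ)/2)) * ‖y ε‖)
      (φ' := fun t => (t ^ ((3:ℝ)/2) + L) * (M + ε * ‖y' ε‖)
        - (t ^ ((5:ℝ)/2) + L * t) * ‖y' ε‖ + (Q - t ^ ((3:ℝ)/2)) * ‖y ε‖) hd ?_ ?_ hx₀
    · have hgε : y' ε - g ε = 0 := by simp [g]
      rw [hgε, zero_sub, norm_neg, ← hN, hpow₅ ε hε.le, hpow₇, ← hQ,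
        Real.zero_rpow (by norm_num), Real.zero_rpow (by norm_num)] at key
      refine key.trans (le_of_eq ?_)
      linear_combination (3 / 5 * ‖y ε‖) * hεQ
    · intro t
      have h₅ : HasDerivAt (fun t : ℝ => t ^ ((5:ℝ)/2)) (5 / 2 * t ^ ((3:ℝ)/2)) t := by
        convert Real.hasDerivAt_rpow_const (x := t) (p := 5 / 2) (Or.inr (by norm_num)) using 3
        norm_num
      have h₇ : HasDerivAt (fun t : ℝ => t ^ ((7:ℝ)/2)) (7 / 2 * t ^ ((5:ℝ)/2)) t := by
        convert Real.hasDerivAt_rpow_const (x := t) (p := 7 / 2) (Or.inr (by norm_num)) using 3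
        norm_num
      have hi := hasDerivAt_id t
      have h := ((((h₅.const_mul (2 / 5)).add (hi.const_mul L)).mul_const
        (M + ε * ‖y' ε‖)).sub
          (((h₇.const_mul (2 / 7)).add (((hi.pow 2).const_mul L).div_const 2)).mul_const
            ‖y' ε‖)).add (((hi.const_mul Q).sub (h₅.const_mul (2 / 5))).mul_const ‖y ε‖)
      refine h.congr_deriv ?_
      simp
      ring
    · intro t ht
      have hq0 : 0 ≤ t ^ ((3:ℝ)/2) := Real.rpow_nonneg ht.1 _
      have hqQ : t ^ ((3:ℝ)/2) ≤ Q := Real.rpow_le_rpow ht.1 ht.2 (by norm_num)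
      have ht' : 0 ≤ ε - t := sub_nonneg.2 ht.2
      rw [hode t ht, hpow₅ t ht.1]
      set q : ℝ := t ^ ((3:ℝ)/2)
      have hsplit : (-(q : ℂ) - lam) * y t + (lam + (Q : ℂ)) * y ε =
          (-((q : ℂ) + lam)) * (y t - (y ε - ((ε - t : ℝ) : ℂ) * y' ε))
          + ((q : ℂ) + lam) * (((ε - t : ℝ) : ℂ) * y' ε) + ((Q - q : ℝ) : ℂ) * y ε := by
        push_cast
        ring
      have hqL : ‖(q : ℂ) + lam‖ ≤ q + L := by
        simpa [abs_of_nonneg hq0] using norm_add_le (q : ℂ) lam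
      rw [hsplit]
      refine norm_add₃_le.trans ?_
      rw [norm_mul, norm_mul, norm_mul, norm_mul, norm_neg, Complex.norm_real,
        Complex.norm_real, Real.norm_of_nonneg ht', Real.norm_of_nonneg (sub_nonneg.2 hqQ)]
      calc _ ≤ (q + L) * M + (q + L) * ((ε - t) * ‖y' ε‖) + (Q - q) * ‖y ε‖ := by
            gcongr
            exact hyM t ht
        _ = _ := by ring
  have hN_le : ‖y' 0 - (y' ε + (ε : ℂ) * (lam + (Q : ℂ)) * y ε)‖ ≤ N := by
    convert hmax' 0 (Set.left_mem_Icc.2 hε.le) using 3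
    simp only [g, sub_zero]
    ring
  refine hN_le.trans ?_
  rw [div_mul_eq_mul_div, le_div_iff₀ (by linarith)]
  rw [hM, hKdef] at hNM
  linarith
end
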